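/- arXiv:2106.04359 — 6 statements merged into one kernel-verified Lean document; each statement's English description precedes it below -/
import Mathlib

section
/- The stationary lattice equation 0 = f(I_j) + I_j^0 + λ(I_{j-1} - 2 I_j + I_{j+1}), j ∈ ℤ, admits a solution (I_j^∞)_{j∈ℤ} that is positive (I_j^∞ > 0 for every j ∈ ℤ) and bounded, and this positive bounded solution is unique. -/
/-- The nonlinearity `f(v) = s₀(1 - e^{-τ v}) - η v`. -/
noncomputable def fSIR (τ η s₀ v : ℝ) : ℝ := s₀ * (1 - Real.exp (-τ * v)) - η * v

lemma aux_growth (a b : ℕ → ℝ) (M c : ℝ) (hc : 0 < c) (ha : ∀ n, 0 < a n) (hb : ∀ n, 0 < b n)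
    (haM : ∀ n, a n ≤ M) (hbM : ∀ n, b n ≤ M)
    (hW : ∀ n, c ≤ b n * a (n + 1) - a n * b (n + 1)) : False := by
  have hM : 0 < M := lt_of_lt_of_le (ha 0) (haM 0)
  have h1 : ∀ n : ℕ, (n : ℝ) * (c / M ^ 2) ≤ a n / b n := by
    intro n
    induction n with
    | zero => simpa using (div_pos (ha 0) (hb 0)).le
    | succ k ih =>
      have hk := hb k
      have hk1 := hb (k + 1)
      have e : a (k + 1) / b (k + 1) - a k / b k
          = (b k * a (k + 1) - a k * b (k + 1)) / (b k * b (k + 1)) := by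
        field_simp
      have h2 : c / M ^ 2 ≤ (b k * a (k + 1) - a k * b (k + 1)) / (b k * b (k + 1)) := by
        apply div_le_div₀ (hc.le.trans (hW k)) (hW k) (by positivity)
        rw [sq]
        exact mul_le_mul (hbM k) (hbM _) hk1.le hM.le
      push_cast
      linarith
  have h3 : ∀ n, a n / b n ≤ M ^ 2 / c := by
    intro n
    have hbn := hb n
    rw [div_le_div_iff₀ hbn hc]
    have h4 : c ≤ b n * M := by
      have := mul_le_mul_of_nonneg_left (haM (n + 1)) hbn.le
      have := mul_pos (ha n) (hb (n + 1))
      linarith [hW n]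
    calc a n * c ≤ M * (b n * M) := mul_le_mul (haM n) h4 hc.le hM.le
      _ = M ^ 2 * b n := by ring
  obtain ⟨n, hn⟩ := exists_nat_gt (M ^ 2 / c / (c / M ^ 2))
  rw [div_lt_iff₀ (by positivity)] at hn
  linarith [h1 n, h3 n]

lemma aux_strict (τ η s₀ : ℝ) (hτ : 0 < τ) (hs : 0 < s₀) (v u : ℝ) (hv : 0 < v) (hvu : v < u) :
    v * fSIR τ η s₀ u < u * fSIR τ η s₀ v := by
  have hu : 0 < u := hv.trans hvu
  have h := strictConvexOn_exp.2 (Set.mem_univ (-τ * u)) (Set.mem_univ (0 : ℝ))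
    (by intro h; nlinarith [mul_pos hτ hu]) (div_pos hv hu)
    (sub_pos.2 ((div_lt_one hu).2 hvu)) (by ring)
  simp only [smul_eq_mul, mul_zero, add_zero, Real.exp_zero, mul_one] at h
  have e : v / u * (-τ * u) = -τ * v := by field_simp
  rw [e] at h
  have h2 := mul_lt_mul_of_pos_left h (mul_pos hs hu)
  have e2 : s₀ * u * (v / u * Real.exp (-τ * u) + (1 - v / u))
      = s₀ * (v * Real.exp (-τ * u) + (u - v)) := by field_simp
  rw [e2] at h2
  unfold fSIR
  nlinarith

lemma aux_eq (τ η lam s₀ : ℝ) (hτ : 0 < τ) (hlam : 0 < lam) (hs : 0 < s₀)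
    (I0 : ℤ → ℝ) (hI0 : ∀ j, 0 ≤ I0 j) (u v : ℤ → ℝ) (M : ℝ)
    (hv : ∀ j, 0 < v j) (hvu : ∀ j, v j ≤ u j) (huM : ∀ j, u j ≤ M)
    (eu : ∀ j : ℤ, 0 = fSIR τ η s₀ (u j) + I0 j + lam * (u (j - 1) - 2 * u j + u (j + 1)))
    (ev : ∀ j : ℤ, 0 = fSIR τ η s₀ (v j) + I0 j + lam * (v (j - 1) - 2 * v j + v (j + 1))) :
    u = v := by
  have hu : ∀ j, 0 < u j := fun j => (hv j).trans_le (hvu j)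
  have hvM : ∀ j, v j ≤ M := fun j => (hvu j).trans (huM j)
  obtain ⟨W, hW⟩ : ∃ W : ℤ → ℝ, ∀ j, W j = v j * u (j + 1) - u j * v (j + 1) := ⟨_, fun _ => rfl⟩
  have key : ∀ j, lam * (W j - W (j - 1)) =
      (u j * fSIR τ η s₀ (v j) - v j * fSIR τ η s₀ (u j)) + I0 j * (u j - v j) := by
    intro j
    rw [hW, hW, sub_add_cancel]
    linear_combination u j * ev j - v j * eu j
  have hlt : ∀ j, v j < u j → W (j - 1) < W j := by
    intro j h
    have h1 := aux_strict τ η s₀ hτ hs _ _ (hv j) h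
    have h2 := mul_nonneg (hI0 j) (sub_nonneg.2 h.le)
    have h3 : 0 < lam * (W j - W (j - 1)) := by rw [key]; linarith
    linarith [pos_of_mul_pos_right h3 hlam.le]
  have hle : ∀ j, W (j - 1) ≤ W j := by
    intro j
    rcases (hvu j).lt_or_eq with h | h
    · exact (hlt j h).le
    · have := key j
      rw [h] at this
      simp only [sub_self, mul_zero, add_zero, mul_eq_zero] at this
      rcases this with h | h <;> linarith
  have hmono : Monotone W := monotone_int_of_le_succ (fun j => by simpa using hle (j + 1))
  by_contra hne
  obtain ⟨j, hj⟩ := Function.ne_iff.1 hne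
  have hj' := hlt j (lt_of_le_of_ne (hvu j) (Ne.symm hj))
  rcases lt_or_ge 0 (W j) with h | h
  · refine aux_growth (fun n : ℕ => u (j + n)) (fun n : ℕ => v (j + n)) M (W j) h
      (fun _ => hu _) (fun _ => hv _) (fun _ => huM _) (fun _ => hvM _) ?_
    intro n
    have h1 : W j ≤ W (j + n) := hmono (by lia)
    rw [hW (j + n)] at h1
    push_cast
    rw [← add_assoc]
    exact h1
  · have h' : 0 < - W (j - 1) := by linarith
    refine aux_growth (fun n : ℕ => u (j - n)) (fun n : ℕ => v (j - n)) M (- W (j - 1)) h'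
      (fun _ => hu _) (fun _ => hv _) (fun _ => huM _) (fun _ => hvM _) ?_
    intro n
    have h1 : W (j - (n + 1)) ≤ W (j - 1) := hmono (by lia)
    rw [hW (j - (n + 1))] at h1
    have e : j - ((n : ℤ) + 1) + 1 = j - n := by ring
    rw [e] at h1
    push_cast
    linarith

lemma aux_exists (τ η lam s₀ : ℝ) (hτ : 0 < τ) (hη : 0 < η) (hlam : 0 < lam) (hs : 0 < s₀)
    (I0 : ℤ → ℝ) (hI0 : ∀ j, 0 ≤ I0 j ∧ I0 j ≤ 1) (hI0ne : ∃ j, I0 j ≠ 0)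
    (M : ℝ) (hM : (s₀ + 1) / η ≤ M) :
    ∃ v : ℤ → ℝ, (∀ j, 0 < v j) ∧ (∀ j, v j ≤ M) ∧
      (∀ j : ℤ, 0 = fSIR τ η s₀ (v j) + I0 j + lam * (v (j - 1) - 2 * v j + v (j + 1))) ∧
      ∀ u : ℤ → ℝ, (∀ j, 0 < u j) → (∀ j, u j ≤ M) →
      (∀ j : ℤ, 0 = fSIR τ η s₀ (u j) + I0 j + lam * (u (j - 1) - 2 * u j + u (j + 1))) →
      ∀ j, v j ≤ u j := by
  have hM0 : 0 ≤ M := le_trans (by positivity) hM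
  have hM' : s₀ + 1 ≤ M * η := (div_le_iff₀ hη).1 hM
  have hd : 0 < η + 2 * lam := by positivity
  have : Fact ((0 : ℝ) ≤ M) := ⟨hM0⟩
  have hexp : ∀ x, 0 ≤ x → 0 ≤ 1 - Real.exp (-τ * x) := by
    intro x hx
    have : Real.exp (-τ * x) ≤ 1 := Real.exp_le_one_iff.2 (by nlinarith [mul_nonneg hτ.le hx])
    linarith
  let T : (ℤ → Set.Icc (0 : ℝ) M) →o (ℤ → Set.Icc (0 : ℝ) M) :=
    { toFun := fun w j => ⟨(s₀ * (1 - Real.exp (-τ * w j)) + I0 j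
          + lam * ((w (j - 1) : ℝ) + w (j + 1))) / (η + 2 * lam), by
        have h0 := (w j).2
        have h1 := (w (j - 1)).2
        have h2 := (w (j + 1)).2
        have h3 := mul_nonneg hs.le (hexp _ h0.1)
        have h4 := mul_nonneg hlam.le (add_nonneg h1.1 h2.1)
        have h5 := mul_le_mul_of_nonneg_left (add_le_add h1.2 h2.2) hlam.le
        have h6 := mul_pos hs (Real.exp_pos (-τ * w j))
        have h7 := hI0 j
        constructor
        · apply div_nonneg _ hd.le
          linarith
        · rw [div_le_iff₀ hd]
          linarith⟩
      monotone' := by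
        intro w w' h j
        have h0 : (w j : ℝ) ≤ w' j := h j
        have h1 : (w (j - 1) : ℝ) ≤ w' (j - 1) := h (j - 1)
        have h2 : (w (j + 1) : ℝ) ≤ w' (j + 1) := h (j + 1)
        have h3 : Real.exp (-τ * w' j) ≤ Real.exp (-τ * w j) :=
          Real.exp_le_exp.2 (by nlinarith)
        show (_ : ℝ) ≤ _
        dsimp only
        gcongr }
  have hfix := T.map_lfp
  have hmin : ∀ a, T a ≤ a → T.lfp ≤ a := fun a h => T.lfp_le h
  generalize T.lfp = w at hfix hmin
  have heq : ∀ j : ℤ, 0 = fSIR τ η s₀ (w j) + I0 j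
      + lam * ((w (j - 1) : ℝ) - 2 * w j + w (j + 1)) := by
    intro j
    have h : (s₀ * (1 - Real.exp (-τ * w j)) + I0 j
          + lam * ((w (j - 1) : ℝ) + w (j + 1))) / (η + 2 * lam) = w j :=
      congrArg Subtype.val (congrFun hfix j)
    rw [div_eq_iff hd.ne'] at h
    unfold fSIR
    linarith
  refine ⟨fun j => w j, ?_, fun j => (w j).2.2, heq, ?_⟩
  · intro j
    by_contra hj
    have hz : (w j : ℝ) = 0 := le_antisymm (not_lt.1 hj) (w j).2.1
    have step : ∀ k, (w k : ℝ) = 0 → I0 k = 0 ∧ (w (k - 1) : ℝ) = 0 ∧ (w (k + 1) : ℝ) = 0 := by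
      intro k hk
      have h := heq k
      rw [hk] at h
      simp only [fSIR, mul_zero, Real.exp_zero, sub_self, sub_zero, zero_add] at h
      have h1 := mul_nonneg hlam.le (w (k - 1)).2.1
      have h2 := mul_nonneg hlam.le (w (k + 1)).2.1
      have h3 := (hI0 k).1
      refine ⟨by linarith, ?_, ?_⟩
      · have : lam * (w (k - 1) : ℝ) = 0 := by linarith
        exact (mul_eq_zero.1 this).resolve_left hlam.ne'
      · have : lam * (w (k + 1) : ℝ) = 0 := by linarith
        exact (mul_eq_zero.1 this).resolve_left hlam.ne'
    have all : ∀ k, (w k : ℝ) = 0 := by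
      intro k
      induction k using Int.inductionOn' (b := j) with
      | zero => exact hz
      | succ k _ ih => exact (step k ih).2.2
      | pred k _ ih => exact (step k ih).2.1
    obtain ⟨k, hk⟩ := hI0ne
    exact hk (step k (all k)).1
  · intro u hu huM eu j
    have h := hmin (fun j => ⟨u j, (hu j).le, huM j⟩) (by
      intro j
      show (s₀ * (1 - Real.exp (-τ * u j)) + I0 j
          + lam * (u (j - 1) + u (j + 1))) / (η + 2 * lam) ≤ u j
      rw [div_le_iff₀ hd]
      have := eu j
      unfold fSIR at this
      linarith)
    exact h j

/-- The stationary lattice equation `0 = f(I_j) + I_j^0 + λ(I_{j-1} - 2 I_j + I_{j+1})`,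
`j ∈ ℤ`, admits a unique positive bounded solution. -/
theorem stmt_0 (τ η lam s₀ : ℝ) (hτ : 0 < τ) (hη : 0 < η) (hlam : 0 < lam)
    (hs₀ : s₀ ∈ Set.Ioo (0 : ℝ) 1)
    (I0 : ℤ → ℝ) (hI0 : ∀ j, 0 ≤ I0 j ∧ I0 j ≤ 1)
    (hI0ne : ∃ j, I0 j ≠ 0) (hI0fin : (Function.support I0).Finite) :
    ∃! I : ℤ → ℝ,
      (∀ j, 0 < I j) ∧ (∃ M : ℝ, ∀ j, I j ≤ M) ∧
      (∀ j : ℤ, 0 = fSIR τ η s₀ (I j) + I0 j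
          + lam * (I (j - 1) - 2 * I j + I (j + 1))) := by
  obtain ⟨v, hv, hvM, ev, -⟩ := aux_exists τ η lam s₀ hτ hη hlam hs₀.1 I0 hI0 hI0ne _ le_rfl
  refine ⟨v, ⟨hv, ⟨_, hvM⟩, ev⟩, ?_⟩
  rintro u ⟨hu, ⟨K, hK⟩, eu⟩
  obtain ⟨z, hz, -, ez, hmin⟩ := aux_exists τ η lam s₀ hτ hη hlam hs₀.1 I0 hI0 hI0ne
    (max ((s₀ + 1) / η) K) (le_max_left _ _)
  have huM := fun j => (hK j).trans (le_max_right ((s₀ + 1) / η) K)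
  have hvM' := fun j => (hvM j).trans (le_max_left ((s₀ + 1) / η) K)
  have h1 := aux_eq τ η lam s₀ hτ hlam hs₀.1 I0 (fun j => (hI0 j).1) u z _ hz
    (hmin u hu huM eu) huM eu ez
  have h2 := aux_eq τ η lam s₀ hτ hlam hs₀.1 I0 (fun j => (hI0 j).1) v z _ hz
    (hmin v hv hvM' ev) hvM' ev ez
  rw [h1, h2]
end

section
/- Let (I_j^∞)_{j∈ℤ} be the unique positive bounded solution of the stationary lattice equation 0 = f(I_j) + I_j^0 + λ(I_{j-1} - 2 I_j + I_{j+1}), j ∈ ℤ. Then I_j^∞ → 0 as |j| → +∞ if 𝓡₀ ≤ 1, while I_j^∞ → I_* as |j| → +∞ if 𝓡₀ > 1, where I_* > 0 is the unique positive zero of f. -/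
open Filter Topology in
theorem half_aux (f : ℝ → ℝ) (hf : Continuous f) (lam a M : ℝ) (hlam : 0 < lam)
    (u : ℕ → ℝ) (hpos : ∀ n, 0 < u n) (hM : ∀ n, u n ≤ M)
    (h1 : ∀ v, 0 < v → v ≤ a → 0 ≤ f v) (h2 : ∀ v, 0 < v → a ≤ v → f v ≤ 0)
    (heq : ∀ n, 0 = f (u (n+1)) + lam * (u n - 2 * u (n+1) + u (n+2))) :
    ∃ L, Tendsto u atTop (𝓝 L) ∧ f L = 0 ∧ (a ≤ L ∨ 0 < L) := by
  have c1 : ∀ n, a ≤ u (n+1) → u (n+1) - u n ≤ u (n+2) - u (n+1) := by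
    intro n hn
    have := h2 _ (hpos (n+1)) hn
    have h := heq n
    have : 0 ≤ lam * (u n - 2 * u (n+1) + u (n+2)) := by linarith
    have := nonneg_of_mul_nonneg_right this hlam
    linarith
  have c2 : ∀ n, u (n+1) ≤ a → u (n+2) - u (n+1) ≤ u (n+1) - u n := by
    intro n hn
    have := h1 _ (hpos (n+1)) hn
    have h := heq n
    have : 0 ≤ lam * -(u n - 2 * u (n+1) + u (n+2)) := by linarith
    have := nonneg_of_mul_nonneg_right this hlam
    linarith
  have A : ∀ n, a ≤ u (n+1) → u (n+1) ≤ u n := by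
    intro n hn
    by_contra hc
    push Not at hc
    obtain ⟨d, hd⟩ : ∃ d, d = u (n+1) - u n := ⟨_, rfl⟩
    have hd0 : 0 < d := by linarith
    have key : ∀ k : ℕ, d ≤ u (n+k+1) - u (n+k) ∧ a + k * d ≤ u (n+k+1) := by
      intro k
      induction k with
      | zero => simp; exact ⟨hd.le, hn⟩
      | succ k ih =>
        have hk : 0 ≤ (k:ℝ) * d := by positivity
        have := c1 (n+k) (by linarith [ih.2])
        have e : n + (k+1) = n + k + 1 := by ring
        rw [e]
        push_cast
        constructor
        · exact ih.1.trans this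
        · have e2 : n + k + 1 + 1 = n + k + 2 := by ring
          rw [e2]; linarith [ih.1, ih.2]
    obtain ⟨k, hk⟩ := exists_nat_gt ((M - a) / d)
    rw [div_lt_iff₀ hd0] at hk
    linarith [(key k).2, hM (n+k+1)]
  have B : ∀ n, u (n+1) ≤ a → u n ≤ u (n+1) := by
    intro n hn
    by_contra hc
    push Not at hc
    obtain ⟨d, hd⟩ : ∃ d, d = u n - u (n+1) := ⟨_, rfl⟩
    have hd0 : 0 < d := by linarith
    have key : ∀ k : ℕ, d ≤ u (n+k) - u (n+k+1) ∧ u (n+k+1) ≤ a - k * d := by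
      intro k
      induction k with
      | zero => simp; exact ⟨hd.le, hn⟩
      | succ k ih =>
        have hk : 0 ≤ (k:ℝ) * d := by positivity
        have := c2 (n+k) (by linarith [ih.2])
        have e : n + (k+1) = n + k + 1 := by ring
        have e2 : n + k + 1 + 1 = n + k + 2 := by ring
        rw [e, e2]
        push_cast
        constructor
        · linarith [ih.1]
        · linarith [ih.1, ih.2]
    obtain ⟨k, hk⟩ := exists_nat_gt (a / d)
    rw [div_lt_iff₀ hd0] at hk
    linarith [(key k).2, hpos (n+k+1)]
  have lim : ∀ L, Tendsto u atTop (𝓝 L) → f L = 0 := by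
    intro L hL
    have t1 := (tendsto_add_atTop_iff_nat 1).2 hL
    have t2 := (tendsto_add_atTop_iff_nat 2).2 hL
    have t := ((hf.tendsto L).comp t1).add
      (((hL.sub (t1.const_mul 2)).add t2).const_mul lam)
    have t0 : Tendsto (fun _ : ℕ => (0:ℝ)) atTop
        (𝓝 (f L + lam * (L - 2 * L + L))) := by
      refine t.congr fun n => ?_
      exact (heq n).symm
    have := tendsto_nhds_unique t0 tendsto_const_nhds
    linarith
  by_cases hall : ∀ n, a ≤ u (n+1)
  · have anti : Antitone u := antitone_nat_of_succ_le fun n => A n (hall n)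
    have hb : BddBelow (Set.range u) := ⟨0, by rintro _ ⟨n, rfl⟩; exact (hpos n).le⟩
    have hL := tendsto_atTop_ciInf anti hb
    refine ⟨_, hL, lim _ hL, Or.inl ?_⟩
    exact ge_of_tendsto ((tendsto_add_atTop_iff_nat 1).2 hL) (Eventually.of_forall hall)
  · push Not at hall
    obtain ⟨m, hm⟩ := hall
    have hlt : ∀ k : ℕ, u (k + (m+1)) < a := by
      intro k
      induction k with
      | zero => simpa using hm
      | succ k ih =>
        by_contra hc
        push Not at hc
        have e : k + 1 + (m+1) = k + (m+1) + 1 := by ring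
        rw [e] at hc
        linarith [A _ hc]
    have mono : Monotone fun k => u (k + (m+1)) := by
      refine monotone_nat_of_le_succ fun k => ?_
      have e : k + 1 + (m+1) = k + (m+1) + 1 := by ring
      have := hlt (k+1)
      rw [e] at this ⊢
      exact B _ this.le
    have hb : BddAbove (Set.range fun k => u (k + (m+1))) :=
      ⟨M, by rintro _ ⟨n, rfl⟩; exact hM _⟩
    have hL' := tendsto_atTop_ciSup mono hb
    have hL := (tendsto_add_atTop_iff_nat (m+1)).1 hL'
    refine ⟨_, hL, lim _ hL, Or.inr ?_⟩
    exact (hpos (0 + (m+1))).trans_le (le_ciSup hb 0)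

open Filter Topology in
theorem full_aux (f : ℝ → ℝ) (hf : Continuous f) (lam a M : ℝ) (hlam : 0 < lam)
    (I0 I : ℤ → ℝ) (hI0fin : (Function.support I0).Finite)
    (hpos : ∀ n, 0 < I n) (hM : ∀ n, I n ≤ M)
    (h1 : ∀ v, 0 < v → v ≤ a → 0 ≤ f v) (h2 : ∀ v, 0 < v → a ≤ v → f v ≤ 0)
    (huniq : ∀ L, f L = 0 → (a ≤ L ∨ 0 < L) → L = a)
    (heq : ∀ j : ℤ, 0 = f (I j) + I0 j + lam * (I (j - 1) - 2 * I j + I (j + 1))) :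
    Tendsto I cofinite (𝓝 a) := by
  have hev : ∀ᶠ j in (cofinite : Filter ℤ), I0 j = 0 := hI0fin
  rw [Int.cofinite_eq, eventually_sup, eventually_atBot, eventually_atTop] at hev
  obtain ⟨⟨P, hP⟩, ⟨N, hN⟩⟩ := hev
  rw [Int.cofinite_eq, tendsto_sup]
  constructor
  · obtain ⟨L, hL, hL0, hLa⟩ := half_aux f hf lam a M hlam (fun n : ℕ => I (P - n))
      (fun n => hpos _) (fun n => hM _) h1 h2 (by
        intro n
        have := heq (P - (n + 1))
        rw [hP _ (by omega)] at this
        have e1 : P - ((n:ℤ) + 1) - 1 = P - (n + 2) := by ring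
        have e2 : P - ((n:ℤ) + 1) + 1 = P - n := by ring
        rw [e1, e2] at this
        push_cast
        linarith)
    rw [huniq L hL0 hLa] at hL
    have ht : Tendsto (fun j : ℤ => (P - j).toNat) atBot atTop := by
      rw [tendsto_atTop]
      intro b
      filter_upwards [eventually_le_atBot (P - b)] with j hj
      omega
    refine (hL.comp ht).congr' ?_
    filter_upwards [eventually_le_atBot P] with j hj
    simp only [Function.comp]
    congr 1
    omega
  · obtain ⟨L, hL, hL0, hLa⟩ := half_aux f hf lam a M hlam (fun n : ℕ => I (N + n))
      (fun n => hpos _) (fun n => hM _) h1 h2 (by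
        intro n
        have := heq (N + (n + 1))
        rw [hN _ (by omega)] at this
        have e1 : N + ((n:ℤ) + 1) - 1 = N + n := by ring
        have e2 : N + ((n:ℤ) + 1) + 1 = N + (n + 2) := by ring
        rw [e1, e2] at this
        push_cast
        linarith)
    rw [huniq L hL0 hLa] at hL
    have ht : Tendsto (fun j : ℤ => (j - N).toNat) atTop atTop := by
      rw [tendsto_atTop]
      intro b
      filter_upwards [eventually_ge_atTop (N + b)] with j hj
      omega
    refine (hL.comp ht).congr' ?_
    filter_upwards [eventually_ge_atTop N] with j hj
    simp only [Function.comp]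
    congr 1
    omega

theorem fSIR_star (τ η s₀ : ℝ) (hs : 0 < s₀) (t v : ℝ) (ht : 0 ≤ t) (ht1 : t ≤ 1) :
    t * fSIR τ η s₀ v ≤ fSIR τ η s₀ (t * v) := by
  have h := convexOn_exp.2 (Set.mem_univ (-τ * v)) (Set.mem_univ 0) ht
    (sub_nonneg.2 ht1) (by ring)
  simp only [smul_eq_mul, mul_zero, add_zero, Real.exp_zero, mul_one] at h
  have e : -τ * (t * v) = t * (-τ * v) := by ring
  unfold fSIR
  rw [e]
  nlinarith [mul_le_mul_of_nonneg_left h hs.le]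

/-- Asymptotic behavior as `|j| → +∞` (i.e. along the cofinite filter on `ℤ`) of
the unique positive bounded solution of the stationary lattice equation:
it tends to `0` when `𝓡₀ = s₀τ/η ≤ 1` and to the unique positive zero `I_*` of `f`
when `𝓡₀ > 1`. -/
theorem stmt_1 (τ η lam s₀ : ℝ) (hτ : 0 < τ) (hη : 0 < η) (hlam : 0 < lam)
    (hs₀ : s₀ ∈ Set.Ioo (0 : ℝ) 1)
    (I0 : ℤ → ℝ) (hI0 : ∀ j, 0 ≤ I0 j ∧ I0 j ≤ 1)
    (hI0ne : ∃ j, I0 j ≠ 0) (hI0fin : (Function.support I0).Finite)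
    (I : ℤ → ℝ)
    (hpos : ∀ j, 0 < I j) (hbdd : ∃ M : ℝ, ∀ j, I j ≤ M)
    (heq : ∀ j : ℤ, 0 = fSIR τ η s₀ (I j) + I0 j
        + lam * (I (j - 1) - 2 * I j + I (j + 1))) :
    (s₀ * τ / η ≤ 1 → Filter.Tendsto I Filter.cofinite (nhds 0)) ∧
    (1 < s₀ * τ / η → ∀ Istar : ℝ, 0 < Istar → fSIR τ η s₀ Istar = 0 →
      (∀ v : ℝ, 0 < v → fSIR τ η s₀ v = 0 → v = Istar) →
      Filter.Tendsto I Filter.cofinite (nhds Istar)) := by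
  have hc : Continuous (fSIR τ η s₀) := by
    unfold fSIR
    fun_prop
  obtain ⟨M, hM⟩ := hbdd
  have hs := hs₀.1
  constructor
  · intro hR
    rw [div_le_one hη] at hR
    have hneg : ∀ v, 0 < v → fSIR τ η s₀ v < 0 := by
      intro v hv
      have h := Real.add_one_lt_exp (x := -τ * v) (by nlinarith [mul_pos hτ hv])
      unfold fSIR
      nlinarith [mul_lt_mul_of_pos_left h hs, mul_le_mul_of_nonneg_right hR hv.le]
    refine full_aux _ hc lam 0 M hlam I0 I hI0fin hpos hM ?_ ?_ ?_ heq
    · intro v hv hv'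
      linarith
    · intro v hv _
      exact (hneg v hv).le
    · intro L hL hL'
      have h0 : 0 ≤ L := hL'.elim id le_of_lt
      rcases h0.eq_or_lt with h | h
      · exact h.symm
      · linarith [hneg L h]
  · intro hR a ha hfa huniq
    refine full_aux _ hc lam a M hlam I0 I hI0fin hpos hM ?_ ?_ ?_ heq
    · intro v hv hva
      have h := fSIR_star τ η s₀ hs (v / a) a (by positivity) ((div_le_one ha).2 hva)
      rwa [hfa, mul_zero, div_mul_cancel₀ _ ha.ne'] at h
    · intro v hv hva
      have h := fSIR_star τ η s₀ hs (a / v) v (by positivity) ((div_le_one hv).2 hva)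
      rw [div_mul_cancel₀ _ hv.ne', hfa] at h
      by_contra hcon
      push Not at hcon
      have : 0 < a / v * fSIR τ η s₀ v := by positivity
      linarith
    · intro L hL hL'
      exact huniq L (hL'.elim (fun h => ha.trans_le h) id) hL
end

section
/- Let (𝓘_j(t))_{j∈ℤ} be a solution of the lattice equation 𝓘_j'(t) = f(𝓘_j(t)) + I_j^0 + λ(𝓘_{j-1}(t) - 2𝓘_j(t) + 𝓘_{j+1}(t)) for t > 0, uniformly bounded on finite time intervals, starting from a nonnegative bounded compactly supported initial condition (𝓘_j(0))_{j∈ℤ}. Then for every j ∈ ℤ, 𝓘_j(t) → I_j^∞ as t → +∞, where (I_j^∞)_{j∈ℤ} is the unique positive bounded solution of the stationary equation 0 = f(I_j) + I_j^0 + λ(I_{j-1} - 2 I_j + I_{j+1}). -/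
open Filter Topology in
theorem aux_liminf_exists (u : ℝ → ℝ) (a b T : ℝ) (h : ∀ t, T ≤ t → a ≤ u t ∧ u t ≤ b) :
    ∃ l, a ≤ l ∧ l ≤ b ∧ (∀ ε > 0, ∀ᶠ t in atTop, l - ε < u t) ∧
      (∀ ε > 0, ∃ᶠ t in atTop, u t < l + ε) := by
  have hE : ∀ᶠ t in atTop, a ≤ u t ∧ u t ≤ b := by
    filter_upwards [eventually_ge_atTop T] with t ht using h t ht
  set S : Set ℝ := {x | ∀ᶠ t in atTop, x ≤ u t} with hS
  have haS : a ∈ S := hE.mono fun t h => h.1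
  have hbS : ∀ x ∈ S, x ≤ b := by
    intro x hx
    obtain ⟨t, h1, h2⟩ := (hx.and hE).exists
    linarith [h2.2]
  have hBdd : BddAbove S := ⟨b, hbS⟩
  refine ⟨sSup S, le_csSup hBdd haS, csSup_le ⟨a, haS⟩ hbS, ?_, ?_⟩
  · intro ε hε
    obtain ⟨x, hx, hlt⟩ := exists_lt_of_lt_csSup ⟨a, haS⟩ (show sSup S - ε < sSup S by linarith)
    exact hx.mono fun t h => by linarith
  · intro ε hε hcon
    have : sSup S + ε ∈ S := hcon.mono fun t h => by linarith [not_lt.1 h]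
    linarith [le_csSup hBdd this]

open Filter Topology in
theorem aux_liminf_ode (u u' r G : ℝ → ℝ) (hG : Continuous G) (l ρ : ℝ)
    (hu : ∀ t, 0 < t → HasDerivAt u (u' t) t) (hu' : ∀ t, 0 < t → G (u t) + r t ≤ u' t)
    (hr : ∀ ε > 0, ∀ᶠ t in atTop, ρ - ε < r t)
    (h1 : ∀ ε > 0, ∀ᶠ t in atTop, l - ε < u t)
    (h2 : ∀ ε > 0, ∃ᶠ t in atTop, u t < l + ε) : G l + ρ ≤ 0 := by
  by_contra hcon
  push Not at hcon
  set δ := (G l + ρ) / 4 with hδ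
  have hδ0 : 0 < δ := by positivity
  obtain ⟨ε, hε, hGε⟩ := Metric.continuousAt_iff.1 (hG.continuousAt (x := l)) δ hδ0
  set e := ε / 2 with he
  have he0 : 0 < e := by positivity
  obtain ⟨T, hT⟩ := eventually_atTop.1 (((hr δ hδ0).and (h1 e he0)).and (eventually_gt_atTop 0))
  set c := 3 * e / δ with hc
  have hc0 : 0 < c := by positivity
  apply h2 (e / 2) (by positivity)
  filter_upwards [eventually_ge_atTop (T + c)] with t ht
  have key : ∀ ⦃x⦄, x ∈ Set.Icc (t - c) t → -u x ≤ -(l - e) - δ / 2 * (x - (t - c)) := by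
    apply image_le_of_deriv_right_lt_deriv_boundary (f := fun x => -u x) (f' := fun x => -u' x)
      (B := fun x => -(l - e) - δ / 2 * (x - (t - c)))
      (B' := fun _ => -(δ / 2))
    · intro x hx
      exact (hu x (hT x (by linarith [hx.1])).2).neg.continuousAt.continuousWithinAt
    · intro x hx
      exact (hu x (hT x (by linarith [hx.1])).2).neg.hasDerivWithinAt
    · have := (hT (t - c) (by linarith)).1.2
      simp only [sub_self, mul_zero]; linarith
    · intro x
      have := (((hasDerivAt_id x).sub_const (t - c)).const_mul (δ / 2)).const_sub (-(l - e))
      simpa using this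
    · intro x hx hxe
      have hx3 := hT x (by linarith [hx.1])
      have a1 : δ / 2 * (x - (t - c)) ≤ δ / 2 * c :=
        mul_le_mul_of_nonneg_left (by linarith [hx.2]) (by positivity)
      have a2 : δ / 2 * c = 3 * e / 2 := by rw [hc]; field_simp
      have a3 : 0 ≤ δ / 2 * (x - (t - c)) := mul_nonneg (by positivity) (by linarith [hx.1])
      have a4 : dist (u x) l < ε := by
        rw [Real.dist_eq, abs_lt]; constructor <;> linarith
      have a5 := hGε a4
      rw [Real.dist_eq, abs_lt] at a5
      have := hu' x hx3.2
      linarith [hx3.1.1, a5.1]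
  have := key (Set.right_mem_Icc.2 (by linarith))
  have a2 : δ / 2 * c = 3 * e / 2 := by rw [hc]; field_simp
  rw [show t - (t - c) = c by ring, a2] at this
  linarith

theorem aux_leftmin (z : ℝ → ℝ) (T t d : ℝ) (ht : t ∈ Set.Icc 0 T) (ht0 : 0 < t)
    (hmin : ∀ s ∈ Set.Icc 0 T, z t ≤ z s) (hd : HasDerivAt z d t) : d ≤ 0 := by
  by_contra hcon
  push Not at hcon
  have h := (hasDerivAt_iff_tendsto_slope_left_right.1 hd).1
  have h2 := h.eventually (lt_mem_nhds hcon)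
  have h3 : ∀ᶠ s in nhdsWithin t (Set.Iio t), s ∈ Set.Ioo 0 t := Ioo_mem_nhdsLT ht0
  obtain ⟨s, hs1, hs2⟩ := (h2.and h3).exists
  rw [slope_def_field] at hs1
  have := hmin s ⟨hs2.1.le, hs2.2.le.trans ht.2⟩
  have := div_nonpos_of_nonneg_of_nonpos (show 0 ≤ z s - z t by linarith)
    (show s - t ≤ 0 by linarith [hs2.2])
  linarith

theorem aux_comparison (w w' : ℤ → ℝ → ℝ) (T C M lam : ℝ) (hT : 0 < T) (hlam : 0 < lam)
    (hcont : ∀ j, ContinuousOn (w j) (Set.Icc 0 T))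
    (hd : ∀ j t, 0 < t → HasDerivAt (w j) (w' j t) t)
    (hM : ∀ j, ∀ t ∈ Set.Icc 0 T, -M ≤ w j t)
    (h0 : ∀ j, 0 ≤ w j 0)
    (hw : ∀ j, ∀ t ∈ Set.Icc 0 T, 0 < t → w j t < 0 →
      lam * (w (j - 1) t - 2 * w j t + w (j + 1) t) + C * w j t ≤ w' j t) :
    ∀ j, ∀ t ∈ Set.Icc 0 T, 0 ≤ w j t := by
  set a := |C| + 2 * lam + 1 with ha
  have ha0 : 0 < a := by positivity
  have hCa : C ≤ |C| := le_abs_self C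
  set z : ℤ → ℝ → ℝ := fun j t => Real.exp (-a * t) * w j t with hz
  by_contra hcon
  push Not at hcon
  obtain ⟨j0, t0, ht0, hneg⟩ := hcon
  have hM0 : 0 < M := by linarith [hM j0 t0 ht0]
  set S : Set ℝ := {x | ∃ j, ∃ t ∈ Set.Icc 0 T, x = z j t} with hS
  have hbd : ∀ x ∈ S, -M ≤ x := by
    rintro x ⟨j, t, ht, rfl⟩
    have e1 : Real.exp (-a * t) ≤ 1 := Real.exp_le_one_iff.2 (by nlinarith [ht.1])
    have e2 := Real.exp_pos (-a * t)
    have := hM j t ht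
    simp only [hz]
    nlinarith
  have hB : BddBelow S := ⟨-M, hbd⟩
  have hmem : z j0 t0 ∈ S := ⟨j0, t0, ht0, rfl⟩
  set m := sInf S with hm
  have hm0 : m < 0 := lt_of_le_of_lt (csInf_le hB hmem)
    (mul_neg_of_pos_of_neg (Real.exp_pos _) hneg)
  obtain ⟨x, ⟨j, t1, ht1, rfl⟩, hx⟩ := exists_lt_of_csInf_lt ⟨_, hmem⟩ (show sInf S < m / 2 by linarith)
  have hzc : ContinuousOn (z j) (Set.Icc 0 T) :=
    ContinuousOn.mul (by fun_prop) (hcont j)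
  obtain ⟨t, ht, hmin⟩ := isCompact_Icc.exists_isMinOn ⟨t1, ht1⟩ hzc
  have hzt : z j t < m / 2 := lt_of_le_of_lt (hmin ht1) hx
  have htpos : 0 < t := by
    rcases ht.1.lt_or_eq with h | h
    · exact h
    · exfalso
      rw [← h] at hzt
      have : 0 ≤ z j 0 := mul_nonneg (Real.exp_pos _).le (h0 j)
      linarith
  have e2 := Real.exp_pos (-a * t)
  have hwneg : w j t < 0 := by
    by_contra hh
    have : 0 ≤ z j t := mul_nonneg e2.le (not_lt.1 hh)
    linarith
  have hder : HasDerivAt (z j) (Real.exp (-a * t) * (-a) * w j t + Real.exp (-a * t) * w' j t) t := by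
    have h1 : HasDerivAt (fun t : ℝ => Real.exp (-a * t)) (Real.exp (-a * t) * (-a)) t := by
      have := ((hasDerivAt_id t).const_mul (-a)).exp
      simpa using this
    exact h1.mul (hd j t htpos)
  have hle := aux_leftmin _ T t _ ht htpos (fun s hs => hmin hs) hder
  have hww := mul_le_mul_of_nonneg_left (hw j t ht htpos hwneg) e2.le
  have n1 : m ≤ z (j - 1) t := csInf_le hB ⟨_, t, ht, rfl⟩
  have n2 : m ≤ z (j + 1) t := csInf_le hB ⟨_, t, ht, rfl⟩
  have expand : Real.exp (-a * t) * (lam * (w (j - 1) t - 2 * w j t + w (j + 1) t) + C * w j t)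
      = lam * (z (j - 1) t - 2 * z j t + z (j + 1) t) + C * z j t := by
    simp only [hz]; ring
  have e3 : Real.exp (-a * t) * (-a) * w j t = -a * z j t := by simp only [hz]; ring
  rw [expand] at hww
  rw [e3] at hle
  have p1 : lam * (2 * m - 2 * z j t) ≤ lam * (z (j - 1) t - 2 * z j t + z (j + 1) t) :=
    mul_le_mul_of_nonneg_left (by linarith) hlam.le
  have p2 : (a - C) * (-z j t) ≥ (2 * lam + 1) * (-z j t) :=
    mul_le_mul_of_nonneg_right (by linarith) (by linarith)
  nlinarith

theorem aux_lower (F : ℝ → ℝ) (lam v0 : ℝ) (hlam : 0 < lam) (B Z : ℤ → ℝ)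
    (hF : ∀ x, 0 < x → x < v0 → 0 < F x) (hB : ∀ j, 0 < B j) (hZ : ∀ j, 0 ≤ Z j)
    (hsup : ∀ j, F (B j) + Z j + lam * (B (j - 1) - 2 * B j + B (j + 1)) ≤ 0) :
    ∀ j, ¬ (B j < v0 ∧ B (j + 1) < B j) := by
  rintro j ⟨h1, h2⟩
  set d := B j - B (j + 1) with hd
  have hd0 : 0 < d := by linarith
  have key : ∀ n : ℕ, B (j + n) ≤ B j - n * d ∧ B (j + n + 1) ≤ B (j + n) - d := by
    intro n
    induction n with
    | zero => simp [hd]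
    | succ n ih =>
      have e1 : B (j + ((n + 1 : ℕ) : ℤ)) = B (j + n + 1) := by congr 1; push_cast; ring
      have e2 : B (j + ((n + 1 : ℕ) : ℤ) + 1) = B (j + n + 1 + 1) := by congr 1; push_cast; ring
      rw [e1, e2]
      have hn : (0 : ℝ) ≤ n * d := by positivity
      refine ⟨by push_cast; linarith, ?_⟩
      have s := hsup (j + n + 1)
      rw [show j + (n : ℤ) + 1 - 1 = j + n by ring] at s
      have f := hF (B (j + n + 1)) (hB _) (by linarith)
      have : lam * (B (j + n) - 2 * B (j + n + 1) + B (j + n + 1 + 1)) < 0 := by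
        linarith [hZ (j + n + 1)]
      have := neg_of_mul_neg_right this hlam.le
      linarith
  obtain ⟨n, hn⟩ := exists_nat_gt (B j / d)
  rw [div_lt_iff₀ hd0] at hn
  linarith [(key n).1, hB (j + n)]

theorem aux_lower2 (F : ℝ → ℝ) (lam v0 : ℝ) (hlam : 0 < lam) (B Z : ℤ → ℝ)
    (hF : ∀ x, 0 < x → x < v0 → 0 < F x) (hB : ∀ j, 0 < B j) (hZ : ∀ j, 0 ≤ Z j)
    (hsup : ∀ j, F (B j) + Z j + lam * (B (j - 1) - 2 * B j + B (j + 1)) ≤ 0) :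
    ∀ j, v0 ≤ B j := by
  intro j
  by_contra h
  push Not at h
  have h1 := aux_lower F lam v0 hlam B Z hF hB hZ hsup j
  have h2 := aux_lower F lam v0 hlam (fun i => B (-i)) (fun i => Z (-i)) hF (fun i => hB _)
    (fun i => hZ _) (fun i => by
      have := hsup (-i)
      rw [show -(i - 1) = -i + 1 by ring, show -(i + 1) = -i - 1 by ring]
      linarith) (-j)
  simp only [neg_neg, show -(-j + 1) = j - 1 by ring] at h2
  have s := hsup j
  have : lam * (B (j - 1) - 2 * B j + B (j + 1)) < 0 := by
    linarith [hZ j, hF (B j) (hB j) h]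
  have := neg_of_mul_neg_right this hlam.le
  by_cases hh : B (j + 1) < B j
  · exact h1 ⟨h, hh⟩
  · exact h2 ⟨h, by linarith⟩

theorem aux_stat (F : ℝ → ℝ) (lam η K : ℝ) (hlam : 0 < lam) (hη : 0 < η) (hFc : Continuous F)
    (hF1 : ∀ x c, 0 < x → 1 < c → F (c * x) < c * F x)
    (hF2 : ∀ x y, x ≤ y → F x - F y ≤ η * (y - x))
    (A B Z : ℤ → ℝ) (hZ : ∀ j, 0 ≤ Z j)
    (hAK : ∀ j, A j ≤ K) (hBK : ∀ j, B j ≤ K) (hB : ∀ j, 0 < B j)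
    (hsub : ∀ j, 0 ≤ F (A j) + Z j + lam * (A (j - 1) - 2 * A j + A (j + 1)))
    (hsup : ∀ j, F (B j) + Z j + lam * (B (j - 1) - 2 * B j + B (j + 1)) ≤ 0) :
    ∀ j, A j ≤ B j := by
  have hK : 0 < K := lt_of_lt_of_le (hB 0) (hBK 0)
  by_contra hcon
  push Not at hcon
  obtain ⟨i, hi⟩ := hcon
  by_cases hcase : ∃ v0 > 0, 0 < F v0
  · obtain ⟨v0, hv0, hFv0⟩ := hcase
    have hlow : ∀ j, v0 ≤ B j := by
      apply aux_lower2 F lam v0 hlam B Z _ hB hZ hsup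
      intro x hx hxv
      have := hF1 x (v0 / x) hx (by rw [lt_div_iff₀ hx]; linarith)
      rw [div_mul_cancel₀ _ hx.ne'] at this
      exact pos_of_mul_pos_right (hFv0.trans this) (by positivity)
    set S : Set ℝ := Set.range fun j => A j / B j with hS
    have hbd : BddAbove S := by
      refine ⟨K / v0, ?_⟩
      rintro _ ⟨j, rfl⟩
      exact div_le_div₀ hK.le (hAK j) hv0 (hlow j)
    set c := sSup S with hc
    have hAc : ∀ j, A j ≤ c * B j := by
      intro j
      have : A j / B j ≤ c := le_csSup hbd ⟨j, rfl⟩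
      rwa [div_le_iff₀ (hB j)] at this
    have hc1 : 1 < c := by
      by_contra h
      nlinarith [hAc i, hB i]
    obtain ⟨x0, hx0, hmin⟩ := (isCompact_Icc (a := v0) (b := K)).exists_isMinOn
      ⟨B 0, hlow 0, hBK 0⟩ (f := fun x => c * F x - F (c * x)) (by fun_prop)
    set m := c * F x0 - F (c * x0) with hm
    have hm0 : 0 < m := by
      have := hF1 x0 c (lt_of_lt_of_le hv0 hx0.1) hc1
      linarith
    set ε := m / (2 * (η + 2 * lam) * K) with hε
    have hε0 : 0 < ε := by positivity
    obtain ⟨_, ⟨j, rfl⟩, hj⟩ := exists_lt_of_lt_csSup (⟨_, ⟨i, rfl⟩⟩ : S.Nonempty)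
      (show c - ε < sSup S by linarith)
    simp only at hj
    rw [lt_div_iff₀ (hB j)] at hj
    have g1 : m ≤ c * F (B j) - F (c * B j) := hmin (show B j ∈ Set.Icc v0 K from ⟨hlow j, hBK j⟩)
    have g2 := hF2 (A j) (c * B j) (hAc j)
    have g3 := hsub j
    have g4 := mul_le_mul_of_nonneg_left (hsup j) (show 0 ≤ c by linarith)
    have g5 : 0 ≤ (c - 1) * Z j := mul_nonneg (by linarith) (hZ j)
    have g6 := mul_le_mul_of_nonneg_left (hAc (j - 1)) hlam.le
    have g7 := mul_le_mul_of_nonneg_left (hAc (j + 1)) hlam.le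
    have g8 : c * B j - A j ≤ ε * K := by
      have := mul_le_mul_of_nonneg_left (hBK j) hε0.le
      linarith
    have g9 : (η + 2 * lam) * (c * B j - A j) ≤ (η + 2 * lam) * (ε * K) :=
      mul_le_mul_of_nonneg_left g8 (by positivity)
    have g10 : (η + 2 * lam) * (ε * K) = m / 2 := by rw [hε]; field_simp
    nlinarith
  · push Not at hcase
    have hneg : ∀ x, 0 < x → F x < 0 := by
      intro x hx
      have := hF1 (x / 2) 2 (by positivity) (by norm_num)
      rw [mul_div_cancel₀ x two_ne_zero] at this
      linarith [hcase (x / 2) (by positivity)]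
    have hsubadd : ∀ x y, 0 < x → 0 < y → F (x + y) ≤ F x + F y := by
      intro x y hx hy
      have a1 := hF1 x ((x + y) / x) hx (by rw [lt_div_iff₀ hx]; linarith)
      have a2 := hF1 y ((x + y) / y) hy (by rw [lt_div_iff₀ hy]; linarith)
      rw [div_mul_cancel₀ _ hx.ne', div_mul_eq_mul_div, lt_div_iff₀ hx] at a1
      rw [div_mul_cancel₀ _ hy.ne', div_mul_eq_mul_div, lt_div_iff₀ hy] at a2
      have : 0 < x + y := by positivity
      by_contra h
      push Not at h
      nlinarith
    set S : Set ℝ := Set.range fun j => A j - B j with hS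
    have hbd : BddAbove S := by
      refine ⟨K, ?_⟩
      rintro _ ⟨j, rfl⟩
      simp only
      linarith [hAK j, hB j]
    set d := sSup S with hd
    have hAd : ∀ j, A j - B j ≤ d := fun j => le_csSup hbd ⟨j, rfl⟩
    have hd0 : 0 < d := by linarith [hAd i]
    set p := -F d with hp
    have hp0 : 0 < p := by linarith [hneg d hd0]
    set ε := min (p / (2 * (η + 2 * lam))) (d / 2) with hε
    have hε0 : 0 < ε := by positivity
    obtain ⟨_, ⟨j, rfl⟩, hj⟩ := exists_lt_of_lt_csSup (⟨_, ⟨i, rfl⟩⟩ : S.Nonempty)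
      (show d - ε < sSup S by linarith)
    simp only at hj
    have hε1 : ε ≤ p / (2 * (η + 2 * lam)) := min_le_left _ _
    have hε2 : ε ≤ d / 2 := min_le_right _ _
    have g1 := hsubadd (B j) (A j - B j) (hB j) (by linarith)
    rw [show B j + (A j - B j) = A j by ring] at g1
    have g2 := hF2 (A j - B j) d (hAd j)
    have g3 := hsub j
    have g4 := hsup j
    have g6 := mul_le_mul_of_nonneg_left (hAd (j - 1)) hlam.le
    have g7 := mul_le_mul_of_nonneg_left (hAd (j + 1)) hlam.le
    have g9 : (η + 2 * lam) * (d - (A j - B j)) ≤ (η + 2 * lam) * (p / (2 * (η + 2 * lam))) :=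
      mul_le_mul_of_nonneg_left (by linarith) (by positivity)
    have g10 : (η + 2 * lam) * (p / (2 * (η + 2 * lam))) = p / 2 := by field_simp
    nlinarith

theorem aux_F1 (τ η s₀ : ℝ) (hτ : 0 < τ) (hs : 0 < s₀) (x c : ℝ) (hx : 0 < x) (hc : 1 < c) :
    fSIR τ η s₀ (c * x) < c * fSIR τ η s₀ x := by
  have hc0 : 0 < c := by linarith
  have h := strictConvexOn_exp.2 (Set.mem_univ (-τ * (c * x))) (Set.mem_univ 0)
    (by have : 0 < τ * (c * x) := by positivity
        intro h; linarith)
    (show 0 < 1 / c by positivity) (show 0 < 1 - 1 / c by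
      rw [sub_pos, div_lt_one hc0]; exact hc) (by ring)
  simp only [smul_eq_mul, mul_zero, add_zero, Real.exp_zero, mul_one] at h
  rw [show 1 / c * (-τ * (c * x)) = -τ * x by field_simp] at h
  have h2 := mul_lt_mul_of_pos_left h hc0
  rw [show c * (1 / c * Real.exp (-τ * (c * x)) + (1 - 1 / c)) = Real.exp (-τ * (c * x)) + (c - 1) by
    field_simp] at h2
  have h3 := mul_lt_mul_of_pos_left h2 hs
  unfold fSIR
  nlinarith

theorem aux_F2 (τ η s₀ : ℝ) (hτ : 0 < τ) (hs : 0 < s₀) (x y : ℝ) (h : x ≤ y) :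
    fSIR τ η s₀ x - fSIR τ η s₀ y ≤ η * (y - x) := by
  have h1 : Real.exp (-τ * y) ≤ Real.exp (-τ * x) := Real.exp_le_exp.2 (by nlinarith)
  have := mul_le_mul_of_nonneg_left h1 hs.le
  unfold fSIR
  linarith

theorem aux_F3 (τ η s₀ M : ℝ) (hτ : 0 < τ) (hη : 0 < η) (hs : 0 < s₀) (v : ℝ) (h : v < 0)
    (hM : -M ≤ v) : s₀ * τ * Real.exp (τ * M) * v ≤ fSIR τ η s₀ v := by
  have h1 := Real.add_one_le_exp (τ * v)
  have h2 := Real.exp_pos (-τ * v)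
  have h3 : Real.exp (τ * v) * Real.exp (-τ * v) = 1 := by
    rw [← Real.exp_add]; simp
  have h4 : Real.exp (-τ * v) ≤ Real.exp (τ * M) := Real.exp_le_exp.2 (by nlinarith)
  have h5 := mul_le_mul_of_nonneg_right h1 h2.le
  have h6 : τ * v * Real.exp (τ * M) ≤ τ * v * Real.exp (-τ * v) :=
    mul_le_mul_of_nonpos_left h4 (by nlinarith)
  have h7 : τ * v * Real.exp (τ * M) ≤ 1 - Real.exp (-τ * v) := by nlinarith
  have h8 := mul_le_mul_of_nonneg_left h7 hs.le
  unfold fSIR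
  nlinarith

/-- Any solution of the lattice equation
`𝓘_j'(t) = f(𝓘_j(t)) + I_j^0 + λ(𝓘_{j-1}(t) - 2𝓘_j(t) + 𝓘_{j+1}(t))`,
uniformly bounded on finite time intervals, starting from a nonnegative bounded
compactly supported initial condition, converges at every site `j` as `t → +∞`
to the unique positive bounded stationary solution `(I_j^∞)`. -/
theorem stmt_2 (τ η lam s₀ : ℝ) (hτ : 0 < τ) (hη : 0 < η) (hlam : 0 < lam)
    (hs₀ : s₀ ∈ Set.Ioo (0 : ℝ) 1)
    (I0 : ℤ → ℝ) (hI0 : ∀ j, 0 ≤ I0 j ∧ I0 j ≤ 1)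
    (hI0ne : ∃ j, I0 j ≠ 0) (hI0fin : (Function.support I0).Finite)
    (𝓘 : ℤ → ℝ → ℝ)
    (hcont : ∀ j, ContinuousOn (𝓘 j) (Set.Ici (0 : ℝ)))
    (hode : ∀ j : ℤ, ∀ t : ℝ, 0 < t → HasDerivAt (𝓘 j)
        (fSIR τ η s₀ (𝓘 j t) + I0 j
          + lam * (𝓘 (j - 1) t - 2 * 𝓘 j t + 𝓘 (j + 1) t)) t)
    (hbdd : ∀ T : ℝ, 0 < T → ∃ M : ℝ, ∀ j : ℤ, ∀ t ∈ Set.Icc (0 : ℝ) T, |𝓘 j t| ≤ M)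
    (hinit_nonneg : ∀ j, 0 ≤ 𝓘 j 0)
    (hinit_bdd : ∃ M : ℝ, ∀ j, 𝓘 j 0 ≤ M)
    (hinit_supp : (Function.support fun j => 𝓘 j 0).Finite)
    (Iinf : ℤ → ℝ)
    (hpos : ∀ j, 0 < Iinf j) (hIbdd : ∃ M : ℝ, ∀ j, Iinf j ≤ M)
    (heq : ∀ j : ℤ, 0 = fSIR τ η s₀ (Iinf j) + I0 j
        + lam * (Iinf (j - 1) - 2 * Iinf j + Iinf (j + 1))) :
    ∀ j : ℤ, Filter.Tendsto (fun t => 𝓘 j t) Filter.atTop (nhds (Iinf j)) := by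
  obtain ⟨hs0, hs1⟩ := hs₀
  have hFc : Continuous (fSIR τ η s₀) := by unfold fSIR; fun_prop
  have hF0 : fSIR τ η s₀ 0 = 0 := by simp [fSIR]
  -- nonnegativity
  have hnn : ∀ j t, 0 ≤ t → 0 ≤ 𝓘 j t := by
    intro j t ht
    have hT : 0 < t + 1 := by linarith
    obtain ⟨M, hM⟩ := hbdd (t + 1) hT
    refine aux_comparison 𝓘 _ (t + 1) (s₀ * τ * Real.exp (τ * M)) M lam hT hlam
      (fun j => (hcont j).mono Set.Icc_subset_Ici_self) hode
      (fun j t ht => (abs_le.1 (hM j t ht)).1) hinit_nonneg ?_ j t ⟨ht, by linarith⟩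
    intro j t ht ht0 hneg
    have := aux_F3 τ η s₀ M hτ hη hs0 (𝓘 j t) hneg (abs_le.1 (hM j t ht)).1
    linarith [(hI0 j).1]
  obtain ⟨M0, hM0⟩ := hinit_bdd
  obtain ⟨M1, hM1⟩ := hIbdd
  set K := max (max M0 M1) ((s₀ + 1) / η) with hK
  have hK0 : M0 ≤ K := (le_max_left _ _).trans (le_max_left _ _)
  have hK1 : M1 ≤ K := (le_max_right _ _).trans (le_max_left _ _)
  have hK2 : s₀ + 1 ≤ η * K := by
    have : (s₀ + 1) / η ≤ K := le_max_right _ _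
    rw [div_le_iff₀ hη] at this
    linarith
  have hup : ∀ j t, 0 ≤ t → 𝓘 j t ≤ K := by
    intro j t ht
    have hT : 0 < t + 1 := by linarith
    obtain ⟨M, hM⟩ := hbdd (t + 1) hT
    have := aux_comparison (fun j t => K - 𝓘 j t) _ (t + 1) 0 (M - K) lam hT hlam
      (fun j => continuousOn_const.sub ((hcont j).mono Set.Icc_subset_Ici_self))
      (fun j t ht => (hode j t ht).const_sub K)
      (fun j t ht => by have := (abs_le.1 (hM j t ht)).2; linarith)
      (fun j => by have := hM0 j; linarith) ?_ j t ⟨ht, by linarith⟩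
    · linarith
    · intro j t ht ht0 hneg
      have e := Real.exp_pos (-τ * 𝓘 j t)
      have e1 : η * K ≤ η * 𝓘 j t := mul_le_mul_of_nonneg_left (by linarith) hη.le
      have : fSIR τ η s₀ (𝓘 j t) + 1 ≤ 0 := by
        unfold fSIR; nlinarith
      have := (hI0 j).2
      linarith
  -- lower limits
  have hL := fun j => aux_liminf_exists (𝓘 j) 0 K 0 (fun t ht => ⟨hnn j t ht, hup j t ht⟩)
  choose L hL0 hLK hL1 hL2 using hL
  have hU := fun j => aux_liminf_exists (fun t => -𝓘 j t) (-K) 0 0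
    (fun t ht => ⟨by linarith [hup j t ht], by linarith [hnn j t ht]⟩)
  choose U hU0 hUK hU1 hU2 using hU
  have hLsup : ∀ j, fSIR τ η s₀ (L j) + I0 j + lam * (L (j - 1) - 2 * L j + L (j + 1)) ≤ 0 := by
    intro j
    have := aux_liminf_ode (𝓘 j) _ (fun t => lam * (𝓘 (j - 1) t + 𝓘 (j + 1) t))
      (fun x => fSIR τ η s₀ x + I0 j - 2 * lam * x) (by fun_prop) (L j)
      (lam * (L (j - 1) + L (j + 1))) (hode j) (fun t ht => by linarith) ?_ (hL1 j) (hL2 j)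
    · linarith
    · intro ε hε
      filter_upwards [hL1 (j - 1) (ε / (2 * lam)) (by positivity),
        hL1 (j + 1) (ε / (2 * lam)) (by positivity)] with t h1 h2
      have h3 := mul_lt_mul_of_pos_left (add_lt_add h1 h2) hlam
      have h4 : lam * (ε / (2 * lam)) = ε / 2 := by field_simp
      nlinarith
  have hUsub : ∀ j, 0 ≤ fSIR τ η s₀ (-U j) + I0 j
      + lam * (-U (j - 1) - 2 * -U j + -U (j + 1)) := by
    intro j
    have := aux_liminf_ode (fun t => -𝓘 j t) _ (fun t => lam * (-𝓘 (j - 1) t + -𝓘 (j + 1) t))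
      (fun x => -fSIR τ η s₀ (-x) - I0 j - 2 * lam * x) (by fun_prop) (U j)
      (lam * (U (j - 1) + U (j + 1))) (fun t ht => (hode j t ht).neg)
      (fun t ht => by simp only [neg_neg]; linarith) ?_ (hU1 j) (hU2 j)
    · linarith
    · intro ε hε
      filter_upwards [hU1 (j - 1) (ε / (2 * lam)) (by positivity),
        hU1 (j + 1) (ε / (2 * lam)) (by positivity)] with t h1 h2
      have h3 := mul_lt_mul_of_pos_left (add_lt_add h1 h2) hlam
      have h4 : lam * (ε / (2 * lam)) = ε / 2 := by field_simp
      nlinarith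
  have hLpos : ∀ j, 0 < L j := by
    by_contra hcon
    push Not at hcon
    obtain ⟨i, hi⟩ := hcon
    have hi0 : L i = 0 := le_antisymm hi (hL0 i)
    have step : ∀ j, L j = 0 → I0 j = 0 ∧ L (j - 1) = 0 ∧ L (j + 1) = 0 := by
      intro j hj
      have h := hLsup j
      rw [hj, hF0] at h
      have a1 := (hI0 j).1
      have a2 := mul_nonneg hlam.le (hL0 (j - 1))
      have a3 := mul_nonneg hlam.le (hL0 (j + 1))
      have b2 : lam * L (j - 1) = 0 := by linarith
      have b3 : lam * L (j + 1) = 0 := by linarith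
      exact ⟨by linarith, (mul_eq_zero.1 b2).resolve_left hlam.ne',
        (mul_eq_zero.1 b3).resolve_left hlam.ne'⟩
    have all : ∀ j, L j = 0 := by
      intro j
      induction j using Int.inductionOn' (b := i) with
      | zero => exact hi0
      | succ k _ ih => exact (step k ih).2.2
      | pred k _ ih => exact (step k ih).2.1
    obtain ⟨j, hj⟩ := hI0ne
    exact hj (step j (all j)).1
  have c1 : ∀ j, -U j ≤ Iinf j :=
    aux_stat (fSIR τ η s₀) lam η K hlam hη hFc (aux_F1 τ η s₀ hτ hs0) (aux_F2 τ η s₀ hτ hs0)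
      (fun j => -U j) Iinf I0 (fun j => (hI0 j).1) (fun j => by linarith [hU0 j])
      (fun j => (hM1 j).trans hK1) hpos hUsub (fun j => (heq j).ge)
  have c2 : ∀ j, Iinf j ≤ L j :=
    aux_stat (fSIR τ η s₀) lam η K hlam hη hFc (aux_F1 τ η s₀ hτ hs0) (aux_F2 τ η s₀ hτ hs0)
      Iinf L I0 (fun j => (hI0 j).1) (fun j => (hM1 j).trans hK1) hLK hLpos
      (fun j => (heq j).le) hLsup
  intro j
  rw [Metric.tendsto_nhds]
  intro ε hε
  filter_upwards [hL1 j ε hε, hU1 j ε hε] with t h1 h2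
  rw [Real.dist_eq, abs_lt]
  constructor <;> linarith [c1 j, c2 j]
end

section
/- Let (S_j(t), I_j(t))_{j∈ℤ} be a bounded solution of the lattice SIR system S_j'(t) = -τ S_j(t) I_j(t), I_j'(t) = τ S_j(t) I_j(t) - η I_j(t) + λ(I_{j-1}(t) - 2 I_j(t) + I_{j+1}(t)) with S_j(0) = s₀ for every j ∈ ℤ and (I_j(0))_{j∈ℤ} a nonnegative, not identically zero, finitely supported sequence with values in (0,1) on its support. Then for every j ∈ ℤ, I_j(t) → 0 as t → +∞. -/
/-- Nonnegativity step. -/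
theorem aux_nonneg (A lam M : ℝ) (hlam : 0 < lam) (hA : 0 ≤ A) (a I : ℤ → ℝ → ℝ)
    (ha : ∀ j t, |a j t| ≤ A) (hI : ∀ j t, |I j t| ≤ M)
    (hc : ∀ j, ContinuousOn (I j) (Set.Ici (0 : ℝ)))
    (hd : ∀ j : ℤ, ∀ t : ℝ, 0 < t →
      HasDerivAt (I j) (a j t * I j t + lam * (I (j - 1) t + I (j + 1) t)) t)
    (h0 : ∀ j, 0 ≤ I j 0) : ∀ j t, 0 ≤ t → 0 ≤ I j t := by
  intro j T hT
  have hM : 0 ≤ M := (abs_nonneg _).trans (hI 0 0)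
  set C : ℝ := 2 * A + 2 * lam with hC
  set M' : ℝ := M * Real.exp (A * T) with hM'
  have hM'0 : 0 ≤ M' := by positivity
  have key : ∀ n : ℕ, ∀ j : ℤ, ∀ t ∈ Set.Icc 0 T,
      0 ≤ Real.exp (A * t) * I j t + M' * ((C * t) ^ n / (n.factorial : ℝ)) := by
    intro n
    induction n with
    | zero =>
      intro j t ht
      have h1 : Real.exp (A * t) ≤ Real.exp (A * T) :=
        Real.exp_le_exp.2 (mul_le_mul_of_nonneg_left ht.2 hA)
      have h2 := (abs_le.1 (hI j t)).1
      have h3 : M * Real.exp (A * t) ≤ M' := mul_le_mul_of_nonneg_left h1 hM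
      have h4 := Real.exp_pos (A * t)
      simp
      nlinarith
    | succ n ih =>
      intro j t ht
      have hder : ∀ x, 0 < x → HasDerivAt
          (fun t => Real.exp (A * t) * I j t + M' * ((C * t) ^ (n+1) / ((n+1).factorial : ℝ)))
          (Real.exp (A * x) * A * I j x + Real.exp (A * x) *
            (a j x * I j x + lam * (I (j - 1) x + I (j + 1) x))
            + M' * (C * ((C * x) ^ n / (n.factorial : ℝ)))) x := by
        intro x hx
        have e1 : HasDerivAt (fun t : ℝ => Real.exp (A * t)) (Real.exp (A * x) * A) x := by
          simpa using ((hasDerivAt_id x).const_mul A).exp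
        have e2 : HasDerivAt (fun t : ℝ => M' * ((C * t) ^ (n+1) / ((n+1).factorial : ℝ)))
            (M' * (C * ((C * x) ^ n / (n.factorial : ℝ)))) x := by
          have := (((((hasDerivAt_id x).const_mul C).pow (n+1)).div_const
            ((n+1).factorial : ℝ)).const_mul M')
          refine HasDerivAt.congr_deriv this ?_
          have : (n.factorial : ℝ) ≠ 0 := by positivity
          rw [Nat.factorial_succ]
          push_cast
          simp only [id, mul_one, Nat.add_sub_cancel]
          field_simp
        exact (e1.mul (hd j x hx)).add e2
      have hmono : MonotoneOn
          (fun t => Real.exp (A * t) * I j t + M' * ((C * t) ^ (n+1) / ((n+1).factorial : ℝ)))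
          (Set.Icc 0 T) := by
        apply monotoneOn_of_deriv_nonneg (convex_Icc 0 T)
        · apply ContinuousOn.add
          · exact (by fun_prop : Continuous fun t : ℝ => Real.exp (A * t)).continuousOn.mul
              ((hc j).mono Set.Icc_subset_Ici_self)
          · fun_prop
        · intro x hx
          rw [interior_Icc] at hx
          exact (hder x hx.1).differentiableAt.differentiableWithinAt
        · intro x hx
          rw [interior_Icc] at hx
          rw [(hder x hx.1).deriv]
          have hx' : x ∈ Set.Icc 0 T := ⟨hx.1.le, hx.2.le⟩
          have i1 := ih j x hx'
          have i2 := ih (j-1) x hx'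
          have i3 := ih (j+1) x hx'
          have b := abs_le.1 (ha j x)
          have hq : 0 ≤ M' * ((C * x) ^ n / (n.factorial : ℝ)) := by
            have := hx.1; positivity
          set q := M' * ((C * x) ^ n / (n.factorial : ℝ))
          have e : M' * (C * ((C * x) ^ n / (n.factorial : ℝ))) = C * q := by
            simp only [q]; ring
          rw [e, hC]
          have p1 := mul_nonneg (by linarith : 0 ≤ A + a j x) i1
          have p2 := mul_nonneg hlam.le i2
          have p3 := mul_nonneg hlam.le i3
          have p4 := mul_nonneg (by linarith : 0 ≤ A - a j x) hq
          nlinarith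
      have := hmono (Set.left_mem_Icc.2 hT) ht ht.1
      refine le_trans ?_ this
      simpa using h0 j
  have hlim : Filter.Tendsto (fun n : ℕ => Real.exp (A * T) * I j T
      + M' * ((C * T) ^ n / (n.factorial : ℝ))) Filter.atTop
      (nhds (Real.exp (A * T) * I j T + M' * 0)) :=
    ((FloorSemiring.tendsto_pow_div_factorial_atTop (C * T)).const_mul M').const_add _
  have := ge_of_tendsto' hlim (fun n => key n j T ⟨hT, le_rfl⟩)
  rw [mul_zero, add_zero] at this
  exact nonneg_of_mul_nonneg_right this (Real.exp_pos _)

/-- For any bounded solution of the lattice SIR system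
`S_j' = -τ S_j I_j`, `I_j' = τ S_j I_j - η I_j + λ(I_{j-1} - 2 I_j + I_{j+1})`
with `S_j(0) = s₀` and a nonnegative, not identically zero, finitely supported
initial density of infected, with values in `(0,1)` on its support, the density
of infected individuals vanishes at every site as `t → +∞`. -/
theorem stmt_3 (τ η lam s₀ : ℝ) (hτ : 0 < τ) (hη : 0 < η) (hlam : 0 < lam)
    (hs₀ : s₀ ∈ Set.Ioo (0 : ℝ) 1)
    (S I : ℤ → ℝ → ℝ)
    (hbdd : ∃ M : ℝ, ∀ j : ℤ, ∀ t : ℝ, |S j t| ≤ M ∧ |I j t| ≤ M)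
    (hcontS : ∀ j, ContinuousOn (S j) (Set.Ici (0 : ℝ)))
    (hcontI : ∀ j, ContinuousOn (I j) (Set.Ici (0 : ℝ)))
    (hodeS : ∀ j : ℤ, ∀ t : ℝ, 0 < t →
        HasDerivAt (S j) (-τ * S j t * I j t) t)
    (hodeI : ∀ j : ℤ, ∀ t : ℝ, 0 < t →
        HasDerivAt (I j) (τ * S j t * I j t - η * I j t
          + lam * (I (j - 1) t - 2 * I j t + I (j + 1) t)) t)
    (hS0 : ∀ j, S j 0 = s₀)
    (hI0nonneg : ∀ j, 0 ≤ I j 0)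
    (hI0ne : ∃ j, I j 0 ≠ 0)
    (hI0fin : (Function.support fun j => I j 0).Finite)
    (hI0range : ∀ j, I j 0 ≠ 0 → I j 0 ∈ Set.Ioo (0 : ℝ) 1) :
    ∀ j : ℤ, Filter.Tendsto (fun t => I j t) Filter.atTop (nhds 0) := by
  obtain ⟨M, hM⟩ := hbdd
  have hM0 : 0 ≤ M := (abs_nonneg _).trans (hM 0 0).1
  have hpos : ∀ j t, 0 ≤ t → 0 ≤ I j t := by
    apply aux_nonneg (τ * M + η + 2 * lam) lam M hlam (by positivity)
      (fun j t => τ * S j t - η - 2 * lam) I _ (fun j t => (hM j t).2) hcontI _ hI0nonneg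
    · intro j t
      have := abs_le.1 (hM j t).1
      rw [abs_le]
      constructor <;> nlinarith
    · intro j t ht
      refine (hodeI j t ht).congr_deriv ?_
      ring
  set E : ℤ → ℝ → ℝ := fun j t => I j (max t 0) with hE
  have hEc : ∀ j, Continuous (E j) := fun j =>
    (hcontI j).comp_continuous (by fun_prop) (fun x => Set.mem_Ici.2 (le_max_right _ _))
  have hE0 : ∀ j t, 0 ≤ E j t := fun j t => hpos j _ (le_max_right _ _)
  set J : ℤ → ℝ → ℝ := fun j t => ∫ s in (0:ℝ)..t, E j s with hJ
  have hJd : ∀ j t, HasDerivAt (J j) (E j t) t := fun j t =>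
    intervalIntegral.integral_hasDerivAt_right ((hEc j).intervalIntegrable _ _)
      ((hEc j).stronglyMeasurableAtFilter _ _) (hEc j).continuousAt
  have hJc : ∀ j, Continuous (J j) := fun j =>
    continuous_iff_continuousAt.2 fun t => (hJd j t).continuousAt
  have hJ0 : ∀ j, J j 0 = 0 := fun j => by simp [hJ]
  have hJmono : ∀ j, Monotone (J j) := fun j =>
    monotone_of_hasDerivAt_nonneg (hJd j) (hE0 j)
  have hJle : ∀ j t, 0 ≤ t → J j t ≤ M * t := by
    intro j t ht
    have : ‖∫ s in (0:ℝ)..t, E j s‖ ≤ M * |t - 0| :=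
      intervalIntegral.norm_integral_le_of_norm_le_const fun x _ => (hM j _).2
    rw [sub_zero, abs_of_nonneg ht] at this
    exact (le_abs_self _).trans this
  have hG : ∀ j t, 0 ≤ t →
      η * J j t - lam * (J (j-1) t - 2 * J j t + J (j+1) t) ≤ 4 * M := by
    intro j t ht
    set G : ℝ → ℝ := fun t => I j t + S j t + η * J j t
      - lam * (J (j-1) t - 2 * J j t + J (j+1) t) with hGdef
    have hGd : ∀ x, 0 < x → HasDerivAt G 0 x := by
      intro x hx
      have hEx : ∀ j, E j x = I j x := fun j => by simp [hE, max_eq_left hx.le]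
      have := ((((hodeI j x hx).add (hodeS j x hx)).add ((hJd j x).const_mul η)).sub
        ((((hJd (j-1) x).sub ((hJd j x).const_mul 2)).add (hJd (j+1) x)).const_mul lam))
      refine HasDerivAt.congr_deriv this ?_
      simp only [hEx]
      ring
    have hGc : ContinuousOn G (Set.Icc 0 t) := by
      have h1 := (hcontI j).mono (Set.Icc_subset_Ici_self : Set.Icc 0 t ⊆ _)
      have h2 := (hcontS j).mono (Set.Icc_subset_Ici_self : Set.Icc 0 t ⊆ _)
      have h3 := hJc j
      have h4 := hJc (j-1)
      have h5 := hJc (j+1)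
      fun_prop
    have hm : AntitoneOn G (Set.Icc 0 t) := by
      apply antitoneOn_of_deriv_nonpos (convex_Icc 0 t) hGc
      · intro x hx
        rw [interior_Icc] at hx
        exact (hGd x hx.1).differentiableAt.differentiableWithinAt
      · intro x hx
        rw [interior_Icc] at hx
        rw [(hGd x hx.1).deriv]
    have := hm (Set.left_mem_Icc.2 ht) (Set.right_mem_Icc.2 ht) ht
    simp only [hGdef, hJ0] at this
    have a1 := abs_le.1 (hM j t).1
    have a2 := abs_le.1 (hM j t).2
    have a3 := abs_le.1 (hM j 0).1
    have a4 := abs_le.1 (hM j 0).2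
    linarith
  have hJb : ∀ j t, 0 ≤ t → J j t ≤ 4 * M / η := by
    intro j t ht
    have hb : BddAbove (Set.range fun j => J j t) :=
      ⟨M * t, by rintro _ ⟨k, rfl⟩; exact hJle k t ht⟩
    set P := ⨆ k, J k t with hP
    have hle : ∀ k, J k t ≤ P := fun k => le_ciSup hb k
    have hP2 : P ≤ (4 * M + 2 * lam * P) / (η + 2 * lam) := by
      apply ciSup_le
      intro k
      rw [le_div_iff₀ (by positivity)]
      have := hG k t ht
      have h1 := mul_le_mul_of_nonneg_left (hle (k-1)) hlam.le
      have h2 := mul_le_mul_of_nonneg_left (hle (k+1)) hlam.le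
      linarith
    rw [le_div_iff₀ (by positivity)] at hP2
    refine (hle j).trans ?_
    rw [le_div_iff₀ hη]
    linarith
  have hEint : ∀ j, MeasureTheory.IntegrableOn (I j) (Set.Ioi 0) := by
    intro j
    have hlim : ∃ l, Filter.Tendsto (J j) Filter.atTop (nhds l) := by
      refine ⟨_, tendsto_atTop_ciSup (hJmono j) ⟨4 * M / η, ?_⟩⟩
      rintro _ ⟨t, rfl⟩
      exact (hJmono j (le_max_left t 0)).trans (hJb j _ (le_max_right _ _))
    obtain ⟨l, hl⟩ := hlim
    have := MeasureTheory.integrableOn_Ioi_deriv_of_nonneg' (a := 0)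
      (fun x _ => hJd j x) (fun x _ => hE0 j x) hl
    refine this.congr_fun ?_ measurableSet_Ioi
    intro x hx
    simp [hE, max_eq_left (le_of_lt (Set.mem_Ioi.1 hx))]
  intro j
  refine MeasureTheory.tendsto_zero_of_hasDerivAt_of_integrableOn_Ioi (a := 0)
    (fun x hx => hodeI j x hx) ?_ (hEint j)
  have hSI : MeasureTheory.IntegrableOn (fun t => S j t * I j t) (Set.Ioi 0) := by
    refine MeasureTheory.Integrable.bdd_mul (c := M) (hEint j) ?_ ?_
    · exact ((hcontS j).mono Set.Ioi_subset_Ici_self).aestronglyMeasurable measurableSet_Ioi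
    · exact Filter.Eventually.of_forall fun x => (hM j x).1
  have hSI2 : MeasureTheory.IntegrableOn (fun t => τ * S j t * I j t) (Set.Ioi 0) := by
    simp only [mul_assoc]
    exact MeasureTheory.Integrable.const_mul hSI τ
  exact (hSI2.sub ((hEint j).const_mul η)).add
    ((((hEint (j-1)).sub ((hEint j).const_mul 2)).add (hEint (j+1))).const_mul lam)
end

section
/- Assume 𝓡₀ > 1 and define c_* := min_{γ>0} [η(𝓡₀ - 1) + λ(e^{-γ} - 2 + e^{γ})]/γ. Let (𝓘_j(t))_{j∈ℤ} be the solution of 𝓘_j'(t) = f(𝓘_j(t)) + I_j^0 + λ(𝓘_{j-1}(t) - 2𝓘_j(t) + 𝓘_{j+1}(t)) with 𝓘_j(0) = 0 for all j ∈ ℤ. Then for every c ∈ (0, c_*), limsup_{t→+∞} sup_{|j| ≤ ct} |𝓘_j(t) - I_j^∞| = 0, where (I_j^∞)_{j∈ℤ} is the unique positive bounded solution of the stationary equation 0 = f(I_j) + I_j^0 + λ(I_{j-1} - 2 I_j + I_{j+1}). -/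
/-- Maximum principle on the lattice. -/
theorem mp (a T K M : ℝ) (hK : 0 ≤ K) (hM : 0 ≤ M) (w : ℤ → ℝ → ℝ)
    (hc : ∀ j, ContinuousOn (w j) (Set.Icc a T))
    (h0 : ∀ j, w j a ≤ 0) (hb : ∀ j, ∀ t ∈ Set.Icc a T, w j t ≤ M)
    (hd : ∀ j, ∀ t ∈ Set.Ioc a T, 0 < w j t → ∃ d, HasDerivAt (w j) d t ∧
      ∀ P, 0 ≤ P → (∀ k, w k t ≤ P) → d ≤ K * P) :
    ∀ j, ∀ t ∈ Set.Icc a T, w j t ≤ 0 := by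
  have key : ∀ n : ℕ, ∀ j, ∀ t ∈ Set.Icc a T,
      w j t ≤ M * ((K * (t - a)) ^ n / (n.factorial : ℝ)) := by
    intro n
    induction n with
    | zero => intro j t ht; simpa using hb j t ht
    | succ n ih =>
      intro j t₁ ht₁
      set G : ℝ → ℝ := fun t => M * ((K * (t - a)) ^ (n+1) / ((n+1).factorial : ℝ)) with hG
      have hGd : ∀ t, HasDerivAt G (K * (M * ((K * (t - a)) ^ n / (n.factorial : ℝ)))) t := by
        intro t
        have h1 : HasDerivAt (fun t => K * (t - a)) K t := by
          simpa using ((hasDerivAt_id t).sub_const a).const_mul K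
        have h2 := ((h1.pow (n+1)).div_const ((n+1).factorial : ℝ)).const_mul M
        refine HasDerivAt.congr_deriv h2 ?_
        have : (n.factorial : ℝ) ≠ 0 := by positivity
        have h3 : (n : ℝ) + 1 ≠ 0 := by positivity
        rw [Nat.factorial_succ]; push_cast
        field_simp
      have hGnn : ∀ t ∈ Set.Icc a T, 0 ≤ G t := by
        intro t ht
        have : 0 ≤ t - a := by linarith [ht.1]
        simp only [hG]; positivity
      have hGc : Continuous G := continuous_iff_continuousAt.2 fun t => (hGd t).continuousAt
      by_contra! hcon
      change G t₁ < w j t₁ at hcon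
      set S := Set.Icc a t₁ ∩ {s | w j s - G s ≤ 0} with hS
      have hsub : Set.Icc a t₁ ⊆ Set.Icc a T := Set.Icc_subset_Icc_right ht₁.2
      have hcd : ContinuousOn (fun s => w j s - G s) (Set.Icc a t₁) :=
        ((hc j).mono hsub).sub hGc.continuousOn
      have hScl : IsClosed S := by
        have := hcd.preimage_isClosed_of_isClosed isClosed_Icc (isClosed_Iic (a := (0:ℝ)))
        exact this
      have haS : a ∈ S := by
        refine ⟨⟨le_rfl, ht₁.1⟩, ?_⟩
        have h1 := h0 j
        have h2 := hGnn a ⟨le_rfl, ht₁.1.trans ht₁.2⟩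
        simp only [Set.mem_ofPred_eq]; linarith
      have hSb : BddAbove S := ⟨t₁, fun s hs => hs.1.2⟩
      have hsS : sSup S ∈ S := hScl.csSup_mem ⟨a, haS⟩ hSb
      set s := sSup S with hs
      have hst : s ≤ t₁ := hsS.1.2
      have hanti : AntitoneOn (fun r => w j r - G r) (Set.Icc s t₁) := by
        refine antitoneOn_of_deriv_nonpos (convex_Icc _ _)
          (hcd.mono (Set.Icc_subset_Icc_left hsS.1.1)) ?_ ?_
        all_goals
          intro r hr
          rw [interior_Icc] at hr
          have hrT : r ∈ Set.Ioc a T := ⟨lt_of_le_of_lt hsS.1.1 hr.1, hr.2.le.trans ht₁.2⟩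
          have hpos : 0 < w j r - G r := by
            by_contra! hle
            have : r ∈ S := ⟨⟨hrT.1.le, hr.2.le⟩, hle⟩
            exact absurd (le_csSup hSb this) (not_le.2 hr.1)
          have hrT' : r ∈ Set.Icc a T := ⟨hrT.1.le, hrT.2⟩
          obtain ⟨d, hd1, hd2⟩ := hd j r hrT (by linarith [hGnn r hrT'])
          have hD := hd1.sub (hGd r)
        · exact hD.differentiableAt.differentiableWithinAt
        · have hD' : HasDerivAt (fun r => w j r - G r) _ r := hD
          rw [hD'.deriv]
          have : 0 ≤ r - a := by linarith [hrT.1]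
          have := hd2 (M * ((K * (r - a)) ^ n / (n.factorial : ℝ))) (by positivity)
            (fun k => ih k r hrT')
          linarith
      have h1 := hanti ⟨le_rfl, hst⟩ ⟨hst, le_rfl⟩ hst
      have h2 : w j s - G s ≤ 0 := hsS.2
      simp only at h1
      linarith
  intro j t ht
  have hlim : Filter.Tendsto (fun n : ℕ => M * ((K * (t - a)) ^ n / (n.factorial : ℝ)))
      Filter.atTop (nhds (M * 0)) :=
    (FloorSemiring.tendsto_pow_div_factorial_atTop (K * (t - a))).const_mul M
  rw [mul_zero] at hlim
  exact ge_of_tendsto' hlim fun n => key n j t ht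

theorem f_lip (τ η s₀ : ℝ) (hτ : 0 < τ) (hη : 0 < η) (hs : 0 < s₀) {x y : ℝ} (hy : 0 ≤ y)
    (hxy : y ≤ x) : fSIR τ η s₀ x - fSIR τ η s₀ y ≤ s₀ * τ * (x - y) := by
  unfold fSIR
  have h1 : Real.exp (-τ * x) = Real.exp (-τ * y) * Real.exp (-τ * (x - y)) := by
    rw [← Real.exp_add]; ring_nf
  have h2 := Real.add_one_le_exp (-τ * (x - y))
  have h3 : Real.exp (-τ * y) ≤ 1 := Real.exp_le_one_iff.2 (by nlinarith)
  have h4 : Real.exp (-τ * (x-y)) ≤ 1 := Real.exp_le_one_iff.2 (by nlinarith)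
  have h5 : Real.exp (-τ * y) - Real.exp (-τ * x) ≤ τ * (x - y) := by
    rw [h1]; nlinarith [Real.exp_pos (-τ * y)]
  have h6 := mul_le_mul_of_nonneg_left h5 hs.le
  nlinarith

theorem f_low (τ η s₀ ε : ℝ) (hτ : 0 < τ) (hs : 0 < s₀) {v : ℝ} (hv : 0 ≤ v)
    (hv0 : s₀ * τ ^ 2 * v ≤ ε) : (s₀ * τ - η - ε) * v ≤ fSIR τ η s₀ v := by
  unfold fSIR
  have hy : 0 ≤ τ * v := by positivity
  have h1 : Real.exp (-τ * v) ≤ 1 - τ * v + (τ * v) ^ 2 := by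
    have h2 := Real.add_one_le_exp (τ * v)
    have h3 : Real.exp (-τ * v) * Real.exp (τ * v) = 1 := by
      rw [← Real.exp_add]; simp
    have h4 := Real.exp_pos (-τ * v)
    have h5 : Real.exp (-τ * v) * (1 + τ * v) ≤ 1 := by nlinarith
    by_contra! hcon
    have h6 : 1 ≤ (1 - τ * v + (τ * v) ^ 2) * (1 + τ * v) := by
      nlinarith [pow_nonneg hy 3]
    nlinarith
  nlinarith [mul_le_mul_of_nonneg_left h1 hs.le, mul_le_mul_of_nonneg_right hv0 hv]

theorem f_conc (τ η s₀ δ M I u z : ℝ) (hτ : 0 < τ) (hs : 0 < s₀) (hδ : 0 < δ) (hI : δ ≤ u)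
    (hz : 0 ≤ z) (hu : u = (1 - z) * I) (hIM : I ≤ M) (huI : u ≤ I) :
    s₀ * Real.exp (-τ * M) * (τ * δ) ^ 2 / 2 * z ≤ fSIR τ η s₀ u - (1 - z) * fSIR τ η s₀ I := by
  have e1 : fSIR τ η s₀ u - (1 - z) * fSIR τ η s₀ I
      = s₀ * (z + (1 - z) * Real.exp (-τ * I) - Real.exp (-τ * u)) := by
    unfold fSIR; linear_combination (-η) * hu
  have hz1 : z ≤ 1 := by
    by_contra! h
    nlinarith
  have e2 : Real.exp (-τ * I) = Real.exp (-τ * u) * Real.exp (-(τ * (I - u))) := by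
    rw [← Real.exp_add]; ring_nf
  have e3 : Real.exp (-τ * u) * Real.exp (τ * u) = 1 := by
    rw [← Real.exp_add]; simp
  have hp : 0 ≤ τ * u := mul_nonneg hτ.le (hδ.le.trans hI)
  have h1 := Real.quadratic_le_exp_of_nonneg hp
  have h2 := Real.add_one_le_exp (-(τ * (I - u)))
  have h3 : z * ((τ * u) ^ 2 / 2) ≤
      z * Real.exp (τ * u) + (1 - z) * Real.exp (-(τ * (I - u))) - 1 := by
    have a1 := mul_le_mul_of_nonneg_left h1 hz
    have a2 := mul_le_mul_of_nonneg_left h2 (sub_nonneg.2 hz1)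
    have : z * (τ * u) = (1 - z) * (τ * (I - u)) := by rw [hu]; ring
    nlinarith
  have e4 : z + (1 - z) * Real.exp (-τ * I) - Real.exp (-τ * u)
    = Real.exp (-τ * u) * (z * Real.exp (τ * u) + (1 - z) * Real.exp (-(τ * (I - u))) - 1) := by
    rw [e2]; linear_combination (-z) * e3
  rw [e1, e4]
  have h5 : Real.exp (-τ * M) ≤ Real.exp (-τ * u) := Real.exp_le_exp.2 (by nlinarith)
  have h6 : (τ * δ) ^ 2 ≤ (τ * u) ^ 2 := by gcongr
  have h7 : Real.exp (-τ * M) * (z * ((τ * δ) ^ 2 / 2)) ≤ Real.exp (-τ * u) *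
      (z * Real.exp (τ * u) + (1 - z) * Real.exp (-(τ * (I - u))) - 1) := by
    calc _ ≤ Real.exp (-τ * u) * (z * ((τ * u) ^ 2 / 2)) := by gcongr
      _ ≤ _ := by gcongr
  calc _ = s₀ * (Real.exp (-τ * M) * (z * ((τ * δ) ^ 2 / 2))) := by ring
    _ ≤ _ := by gcongr

/-- the solution hypotheses, bundled -/
structure Sol (τ η lam s₀ : ℝ) (I0 : ℤ → ℝ) (u : ℤ → ℝ → ℝ) : Prop where
  hτ : 0 < τ
  hη : 0 < η
  hlam : 0 < lam
  hs : 0 < s₀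
  hI0 : ∀ j, 0 ≤ I0 j
  hne : ∃ j, I0 j ≠ 0
  hcont : ∀ j, ContinuousOn (u j) (Set.Ici (0 : ℝ))
  hode : ∀ j : ℤ, ∀ t : ℝ, 0 < t → HasDerivAt (u j)
        (fSIR τ η s₀ (u j t) + I0 j + lam * (u (j - 1) t - 2 * u j t + u (j + 1) t)) t
  hbdd : ∀ T : ℝ, 0 < T → ∃ M : ℝ, ∀ j : ℤ, ∀ t ∈ Set.Icc (0 : ℝ) T, |u j t| ≤ M
  hinit : ∀ j : ℤ, u j 0 = 0

namespace Sol
variable {τ η lam s₀ : ℝ} {I0 : ℤ → ℝ} {u : ℤ → ℝ → ℝ}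

theorem cont (h : Sol τ η lam s₀ I0 u) (j : ℤ) {a T : ℝ} (ha : 0 ≤ a) :
    ContinuousOn (u j) (Set.Icc a T) :=
  (h.hcont j).mono fun _ hx => ha.trans hx.1

theorem nonneg (h : Sol τ η lam s₀ I0 u) (j : ℤ) (t : ℝ) (ht : 0 ≤ t) : 0 ≤ u j t := by
  have hτ := h.hτ
  have hη := h.hη
  have hlam := h.hlam
  have hs := h.hs
  obtain ⟨M, hM⟩ := h.hbdd (t + 1) (by linarith)
  have hM0 : 0 ≤ M := (abs_nonneg _).trans (hM 0 0 ⟨le_rfl, by linarith⟩)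
  have := mp 0 (t+1) (s₀ * τ * Real.exp (τ * M) + 2 * lam) M (by positivity) hM0
    (fun j t => - u j t) (fun j => (h.cont j le_rfl).neg) (fun j => by simp [h.hinit])
    (fun j t ht => by linarith [neg_abs_le (u j t), hM j t ht]) ?_ j t ⟨ht, by linarith⟩
  · simpa using this
  · intro j t ht hpos
    refine ⟨_, (h.hode j t ht.1).neg, ?_⟩
    intro P hP hk
    have h1 := hk j
    have h2 := hk (j-1)
    have h3 := hk (j+1)
    beta_reduce at h1 h2 h3 hpos
    have hb : - u j t ≤ M := by linarith [neg_abs_le (u j t), hM j t ⟨ht.1.le, ht.2⟩]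
    have hf : - fSIR τ η s₀ (u j t) ≤ s₀ * τ * Real.exp (τ * M) * P := by
      unfold fSIR
      have e1 : Real.exp (-τ * u j t) - 1 ≤ (-τ * u j t) * Real.exp (τ * M) := by
        have a1 := Real.add_one_le_exp (τ * u j t)
        have a2 : Real.exp (-τ * u j t) * Real.exp (τ * u j t) = 1 := by
          rw [← Real.exp_add]; simp
        have a3 : Real.exp (-τ * u j t) ≤ Real.exp (τ * M) := Real.exp_le_exp.2 (by nlinarith)
        have a4 : 0 ≤ -τ * u j t := by nlinarith
        have a5 := mul_le_mul_of_nonneg_left a3 a4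
        have a6 := mul_le_mul_of_nonneg_left a1 (Real.exp_pos (-τ * u j t)).le
        nlinarith
      have e2 := mul_le_mul_of_nonneg_left e1 hs.le
      have e3 : s₀ * (τ * Real.exp (τ * M)) * (- u j t) ≤ s₀ * (τ * Real.exp (τ * M)) * P := by
        gcongr
      nlinarith
    have := h.hI0 j
    nlinarith

theorem mono (h : Sol τ η lam s₀ I0 u) (j : ℤ) {t₁ t₂ : ℝ} (ht : 0 ≤ t₁) (h12 : t₁ ≤ t₂) :
    u j t₁ ≤ u j t₂ := by
  have hτ := h.hτ
  have hη := h.hη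
  have hlam := h.hlam
  have hs := h.hs
  obtain ⟨M, hM⟩ := h.hbdd (t₁ + 1) (by linarith)
  have hM0 : 0 ≤ M := (abs_nonneg _).trans (hM 0 0 ⟨le_rfl, by linarith⟩)
  set r := t₂ - t₁ with hr
  have hr0 : 0 ≤ r := by linarith
  have := mp 0 (t₁+1) (s₀ * τ + 2 * lam) M (by positivity) hM0
    (fun j t => u j t - u j (t + r)) (fun j => (h.cont j le_rfl).sub ?_)
    (fun j => ?_)
    (fun j t ht => by
      have := h.nonneg j (t + r) (by linarith [ht.1])
      linarith [le_abs_self (u j t), hM j t ht]) ?_ j t₁ ⟨ht, by linarith⟩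
  · beta_reduce at this
    have e : t₁ + r = t₂ := by rw [hr]; ring
    rw [e] at this; linarith
  · exact (h.hcont j).comp (by fun_prop) (fun x hx => by
      simp only [Set.mem_Ici]; linarith [hx.1])
  · simp only [h.hinit]; linarith [h.nonneg j (0 + r) (by linarith)]
  · intro j t ht hpos
    refine ⟨_, (h.hode j t ht.1).sub
      ((h.hode j (t+r) (by linarith [ht.1])).comp_add_const t r), ?_⟩
    intro P hP hk
    have h1 := hk j
    have h2 := hk (j-1)
    have h3 := hk (j+1)
    beta_reduce at h1 h2 h3 hpos
    have hf := f_lip τ η s₀ hτ hη hs (h.nonneg j (t+r) (by linarith [ht.1])) (x := u j t)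
      (by linarith)
    have : s₀ * τ * (u j t - u j (t+r)) ≤ s₀ * τ * P := by gcongr
    nlinarith

theorem le_stat (h : Sol τ η lam s₀ I0 u) (I : ℤ → ℝ) (hpos : ∀ j, 0 < I j)
    (heq : ∀ j : ℤ, 0 = fSIR τ η s₀ (I j) + I0 j + lam * (I (j - 1) - 2 * I j + I (j + 1)))
    (j : ℤ) {t : ℝ} (ht : 0 ≤ t) : u j t ≤ I j := by
  have hτ := h.hτ
  have hη := h.hη
  have hlam := h.hlam
  have hs := h.hs
  obtain ⟨M, hM⟩ := h.hbdd (t + 1) (by linarith)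
  have hM0 : 0 ≤ M := (abs_nonneg _).trans (hM 0 0 ⟨le_rfl, by linarith⟩)
  have := mp 0 (t+1) (s₀ * τ + 2 * lam) M (by positivity) hM0
    (fun j t => u j t - I j) (fun j => (h.cont j le_rfl).sub continuousOn_const)
    (fun j => by simp only [h.hinit]; linarith [hpos j])
    (fun j t ht => by linarith [le_abs_self (u j t), hM j t ht, hpos j]) ?_ j t ⟨ht, by linarith⟩
  · linarith
  · intro j t ht hp
    refine ⟨_, (h.hode j t ht.1).sub_const _, ?_⟩
    intro P hP hk
    have h1 := hk j
    have h2 := hk (j-1)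
    have h3 := hk (j+1)
    beta_reduce at h1 h2 h3 hp
    have hf := f_lip τ η s₀ hτ hη hs (hpos j).le (x := u j t) (by linarith)
    have : s₀ * τ * (u j t - I j) ≤ s₀ * τ * P := by gcongr
    have := heq j
    nlinarith

theorem pos_aux (h : Sol τ η lam s₀ I0 u) (j : ℤ)
    (hj : 0 < I0 j ∨ (∀ t, 0 < t → 0 < u (j-1) t) ∨ (∀ t, 0 < t → 0 < u (j+1) t)) :
    ∀ t, 0 < t → 0 < u j t := by
  have hτ := h.hτ
  have hη := h.hη
  have hlam := h.hlam
  have hs := h.hs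
  have hsm : StrictMonoOn (fun t => Real.exp ((η + 2 * lam) * t) * u j t) (Set.Ici 0) := by
    refine strictMonoOn_of_deriv_pos (convex_Ici 0) ?_ ?_
    · exact ContinuousOn.mul (by fun_prop) (h.hcont j)
    · intro t ht
      rw [interior_Ici] at ht
      have ht : 0 < t := ht
      have hE : HasDerivAt (fun t => Real.exp ((η + 2 * lam) * t))
          (Real.exp ((η + 2 * lam) * t) * (η + 2 * lam)) t := by
        simpa using ((hasDerivAt_id t).const_mul (η + 2 * lam)).exp
      have hD : HasDerivAt (fun t => Real.exp ((η + 2 * lam) * t) * u j t) _ t :=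
        hE.mul (h.hode j t ht)
      rw [hD.deriv]
      have hu := h.nonneg j t ht.le
      have hf : - η * u j t ≤ fSIR τ η s₀ (u j t) := by
        unfold fSIR
        have : Real.exp (-τ * u j t) ≤ 1 := Real.exp_le_one_iff.2 (by nlinarith)
        nlinarith
      have h1 := h.nonneg (j-1) t ht.le
      have h2 := h.nonneg (j+1) t ht.le
      have h3 := h.hI0 j
      have hp : 0 < I0 j + lam * u (j-1) t + lam * u (j+1) t := by
        rcases hj with hj | hj | hj
        · positivity
        · have := hj t ht; positivity
        · have := hj t ht; positivity
      have hsum : 0 < (η + 2 * lam) * u j t + (fSIR τ η s₀ (u j t) + I0 j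
        + lam * (u (j - 1) t - 2 * u j t + u (j + 1) t)) := by nlinarith
      have := mul_pos (Real.exp_pos ((η + 2 * lam) * t)) hsum
      linarith
  intro t ht
  have := hsm (Set.self_mem_Ici) (Set.mem_Ici.2 ht.le) ht
  simp only [h.hinit, mul_zero] at this
  exact pos_of_mul_pos_right this (Real.exp_pos _).le

theorem pos (h : Sol τ η lam s₀ I0 u) (j : ℤ) : ∀ t, 0 < t → 0 < u j t := by
  obtain ⟨j0, hj0⟩ := h.hne
  have h0 := h.pos_aux j0 (Or.inl (lt_of_le_of_ne (h.hI0 j0) hj0.symm))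
  induction j using Int.inductionOn' (b := j0) with
  | zero => exact h0
  | succ k _ ih => exact h.pos_aux (k+1) (Or.inr (Or.inl (by simpa using ih)))
  | pred k _ ih => exact h.pos_aux (k-1) (Or.inr (Or.inr (by simpa using ih)))

theorem reflect (h : Sol τ η lam s₀ I0 u) :
    Sol τ η lam s₀ (fun j => I0 (-j)) (fun j => u (-j)) where
  hτ := h.hτ
  hη := h.hη
  hlam := h.hlam
  hs := h.hs
  hI0 := fun j => h.hI0 _
  hne := by obtain ⟨j, hj⟩ := h.hne; exact ⟨-j, by simpa using hj⟩
  hcont := fun j => h.hcont _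
  hode := fun j t ht => by
    have := h.hode (-j) t ht
    have e1 : -(j-1) = -j+1 := by ring
    have e2 : -(j+1) = -j-1 := by ring
    rw [e1, e2]
    convert this using 1
    ring
  hbdd := fun T hT => by
    obtain ⟨M, hM⟩ := h.hbdd T hT
    exact ⟨M, fun j => hM _⟩
  hinit := fun j => h.hinit _

end Sol
/-- truncated bump -/
noncomputable def bump (α β x : ℝ) : ℝ :=
  Real.exp (-α * x) * Real.cos (max (-(Real.pi / 2)) (min (Real.pi / 2) (β * x)))

theorem bump_nonneg (α β x : ℝ) : 0 ≤ bump α β x := by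
  unfold bump
  have hpi := Real.pi_pos
  refine mul_nonneg (Real.exp_pos _).le (Real.cos_nonneg_of_mem_Icc ⟨le_max_left _ _, ?_⟩)
  exact max_le (by linarith) (min_le_left _ _)

theorem bump_cont (α β : ℝ) : Continuous (bump α β) := by
  unfold bump; fun_prop

theorem bump_zero (α β : ℝ) : bump α β 0 = 1 := by
  have hpi := Real.pi_pos
  unfold bump
  have : max (-(Real.pi / 2)) (min (Real.pi / 2) (β * 0)) = 0 := by
    rw [mul_zero, min_eq_right (by linarith), max_eq_right (by linarith)]
  rw [this]; simp

theorem bump_eq (α β x : ℝ) (h1 : -(Real.pi / 2) ≤ β * x) (h2 : β * x ≤ Real.pi / 2) :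
    bump α β x = Real.exp (-α * x) * Real.cos (β * x) := by
  unfold bump; rw [min_eq_right h2, max_eq_right h1]

theorem bump_out (α β x : ℝ) (h : 0 < bump α β x) :
    -(Real.pi / 2) < β * x ∧ β * x < Real.pi / 2 := by
  have hpi := Real.pi_pos
  constructor
  · by_contra! hc
    have : bump α β x = 0 := by
      unfold bump
      rw [max_eq_left ((min_le_right _ _).trans hc)]; simp
    linarith
  · by_contra! hc
    have : bump α β x = 0 := by
      unfold bump
      rw [min_eq_left hc, max_eq_right (by linarith)]; simp
    linarith

theorem bump_ge (α β x : ℝ) (h1 : -(3 * Real.pi / 2) ≤ β * x) (h2 : β * x ≤ 3 * Real.pi / 2) :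
    Real.exp (-α * x) * Real.cos (β * x) ≤ bump α β x := by
  have hpi := Real.pi_pos
  rcases le_or_gt (β * x) (-(Real.pi / 2)) with h | h
  · have : Real.cos (β * x) ≤ 0 := by
      rw [← Real.cos_neg]
      exact Real.cos_nonpos_of_pi_div_two_le_of_le (by linarith) (by linarith)
    exact (mul_nonpos_of_nonneg_of_nonpos (Real.exp_pos _).le this).trans (bump_nonneg _ _ _)
  · rcases le_or_gt (β * x) (Real.pi / 2) with h' | h'
    · exact (bump_eq α β x h.le h').ge
    · have : Real.cos (β * x) ≤ 0 :=
        Real.cos_nonpos_of_pi_div_two_le_of_le (by linarith) (by linarith)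
      exact (mul_nonpos_of_nonneg_of_nonpos (Real.exp_pos _).le this).trans (bump_nonneg _ _ _)

theorem bump_le (α β x : ℝ) (hα : 0 < α) (hβ : 0 < β) :
    bump α β x ≤ Real.exp (α * (Real.pi / 2 / β)) := by
  rcases (bump_nonneg α β x).eq_or_lt with h | h
  · rw [← h]; exact (Real.exp_pos _).le
  · obtain ⟨h1, h2⟩ := bump_out α β x h
    rw [bump_eq α β x h1.le h2.le]
    have hx : -x ≤ Real.pi / 2 / β := by rw [le_div_iff₀ hβ]; linarith
    calc _ ≤ Real.exp (-α * x) * 1 := by gcongr; exact Real.cos_le_one _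
      _ ≤ _ := by
        rw [mul_one]; apply Real.exp_le_exp.2; nlinarith

/-- the differential inequality of the bump -/
theorem bump_ineq (α β x lam c b : ℝ) (hβ : 0 < β) (hβ1 : β ≤ 1)
    (hlam : 0 < lam) (hc : c * β = 2 * lam * Real.sinh α * Real.sin β)
    (hb : c * α ≤ b + lam * (2 * Real.cosh α * Real.cos β - 2))
    (h : 0 < bump α β x) : ∃ d, HasDerivAt (bump α β) d x ∧
      -c * d ≤ b * bump α β x +
        lam * (bump α β (x - 1) - 2 * bump α β x + bump α β (x + 1)) := by
  have hpi := Real.pi_gt_three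
  obtain ⟨h1, h2⟩ := bump_out α β x h
  have e1 : HasDerivAt (fun x => Real.exp (-α * x)) (Real.exp (-α * x) * (-α)) x := by
    simpa using ((hasDerivAt_id x).const_mul (-α)).exp
  have e2 : HasDerivAt (fun x => Real.cos (β * x)) (-Real.sin (β * x) * β) x := by
    simpa using ((hasDerivAt_id x).const_mul β).cos
  have hD := e1.mul e2
  have hev : bump α β =ᶠ[nhds x] fun x => Real.exp (-α * x) * Real.cos (β * x) := by
    have hc1 : ContinuousAt (fun y => β * y) x := by fun_prop
    filter_upwards [hc1.eventually (lt_mem_nhds h1), hc1.eventually (gt_mem_nhds h2)] with y a1 a2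
    exact bump_eq α β y a1.le a2.le
  refine ⟨_, hD.congr_of_eventuallyEq hev, ?_⟩
  have b1 := bump_ge α β (x - 1) (by nlinarith) (by nlinarith)
  have b2 := bump_ge α β (x + 1) (by nlinarith) (by nlinarith)
  have b0 := bump_eq α β x h1.le h2.le
  have hcos : 0 < Real.cos (β * x) := Real.cos_pos_of_mem_Ioo ⟨h1, h2⟩
  have x1 : Real.exp (-α * (x - 1)) = Real.exp (-α * x) * (Real.cosh α + Real.sinh α) := by
    rw [Real.cosh_add_sinh, ← Real.exp_add]; ring_nf
  have x2 : Real.exp (-α * (x + 1)) = Real.exp (-α * x) * (Real.cosh α - Real.sinh α) := by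
    rw [Real.cosh_sub_sinh, ← Real.exp_add]; ring_nf
  have y1 : Real.cos (β * (x - 1)) = Real.cos (β * x) * Real.cos β + Real.sin (β * x) * Real.sin β := by
    rw [mul_sub, mul_one, Real.cos_sub]
  have y2 : Real.cos (β * (x + 1)) = Real.cos (β * x) * Real.cos β - Real.sin (β * x) * Real.sin β := by
    rw [mul_add, mul_one, Real.cos_add]
  rw [x1, y1] at b1
  rw [x2, y2] at b2
  have hE := Real.exp_pos (-α * x)
  set E := Real.exp (-α * x)
  set C := Real.cos (β * x)
  set S := Real.sin (β * x)
  have hEC : 0 < E * C := mul_pos hE hcos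
  have k1 := mul_le_mul_of_nonneg_right hb hEC.le
  have k2 := mul_le_mul_of_nonneg_left (add_le_add b1 b2) hlam.le
  have k3 : c * β * (E * S) = 2 * lam * Real.sinh α * Real.sin β * (E * S) := by rw [hc]
  rw [b0]
  linear_combination k1 + k2 + k3

theorem exists_params (a lam γ cstar c : ℝ) (hlam : 0 < lam) (hγ : 0 < γ) (hc0 : 0 < c)
    (hcs : cstar = (a + lam * (Real.exp (-γ) - 2 + Real.exp γ)) / γ)
    (hmin : ∀ g, 0 < g → cstar ≤ (a + lam * (Real.exp (-g) - 2 + Real.exp g)) / g)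
    (hc : c < cstar) :
    ∃ α β c₁ ε : ℝ, 0 < α ∧ 0 < β ∧ β ≤ 1 ∧ 0 < ε ∧ c < c₁ ∧
      c₁ * β = 2 * lam * Real.sinh α * Real.sin β ∧
      c₁ * α ≤ (a - ε) + lam * (2 * Real.cosh α * Real.cos β - 2) := by
  have hcosh : ∀ g, Real.exp (-g) - 2 + Real.exp g = 2 * Real.cosh g - 2 := by
    intro g; rw [Real.cosh_eq]; ring
  simp only [hcosh] at hcs hmin
  -- critical point
  have hd : HasDerivAt (fun g => (a + lam * (2 * Real.cosh g - 2)) / g)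
      ((lam * (2 * Real.sinh γ) * γ - (a + lam * (2 * Real.cosh γ - 2)) * 1) / γ ^ 2) γ := by
    refine HasDerivAt.div ?_ (hasDerivAt_id γ) hγ.ne'
    exact ((((Real.hasDerivAt_cosh γ).const_mul 2).sub_const 2).const_mul lam).const_add a
  have hloc : IsLocalMin (fun g => (a + lam * (2 * Real.cosh g - 2)) / g) γ := by
    filter_upwards [lt_mem_nhds hγ] with g hg
    rw [← hcs]; exact hmin g hg
  have hz := hloc.hasDerivAt_eq_zero hd
  have hz1 : lam * (2 * Real.sinh γ) * γ = a + lam * (2 * Real.cosh γ - 2) := by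
    have : γ ^ 2 ≠ 0 := by positivity
    rw [div_eq_zero_iff] at hz
    rcases hz with hz | hz
    · linarith
    · exact absurd hz this
  have hcs2 : cstar = 2 * lam * Real.sinh γ := by
    rw [hcs, ← hz1]; field_simp
  -- choose α
  have hα : ∃ α, 0 < α ∧ α < γ ∧ c < 2 * lam * Real.sinh α := by
    have hct : ContinuousAt (fun g => 2 * lam * Real.sinh g) γ := by
      have := Real.continuous_sinh; fun_prop
    have h1 := hct.eventually (lt_mem_nhds (a := c) (by beta_reduce; rw [← hcs2]; exact hc))
    have h2 := h1.and (lt_mem_nhds hγ)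
    have h3 : ∀ᶠ g in nhdsWithin γ (Set.Iio γ), _ := (h2.filter_mono nhdsWithin_le_nhds).and
      self_mem_nhdsWithin
    obtain ⟨α, ⟨h4, h5⟩, h6⟩ := h3.exists
    exact ⟨α, h5, h6, h4⟩
  obtain ⟨α, hα0, hαγ, hcα⟩ := hα
  have hanti : StrictAntiOn (fun g => a + lam * (2 * Real.cosh g - 2) - 2 * lam * (g * Real.sinh g))
      (Set.Icc α γ) := by
    refine strictAntiOn_of_deriv_neg (convex_Icc _ _) ?_ ?_
    · have := Real.continuous_sinh
      have := Real.continuous_cosh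
      fun_prop
    · intro g hg
      rw [interior_Icc] at hg
      have e : HasDerivAt (fun g => a + lam * (2 * Real.cosh g - 2) - 2 * lam * (g * Real.sinh g))
          (lam * (2 * Real.sinh g) - 2 * lam * (1 * Real.sinh g + g * Real.cosh g)) g := by
        refine HasDerivAt.sub ?_ (((hasDerivAt_id g).mul (Real.hasDerivAt_sinh g)).const_mul _)
        exact ((((Real.hasDerivAt_cosh g).const_mul 2).sub_const 2).const_mul lam).const_add a
      rw [e.deriv]
      have : 0 < lam * (g * Real.cosh g) := by
        have := Real.cosh_pos g
        have : 0 < g := hα0.trans hg.1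
        positivity
      linarith
  have hlt := hanti ⟨le_rfl, hαγ.le⟩ ⟨hαγ.le, le_rfl⟩ hαγ
  have hH : 0 < a + lam * (2 * Real.cosh α - 2) - 2 * lam * (α * Real.sinh α) := by
    simp only at hlt; linarith
  -- choose β
  have hsinc : Filter.Tendsto (fun β => 2 * lam * Real.sinh α * Real.sinc β) (nhds 0)
      (nhds (2 * lam * Real.sinh α)) := by
    have : Continuous (fun β => 2 * lam * Real.sinh α * Real.sinc β) := by
      have := Real.continuous_sinc; fun_prop
    simpa using this.tendsto 0
  have hfun : Filter.Tendsto (fun β => a + lam * (2 * Real.cosh α * Real.cos β - 2)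
      - 2 * lam * Real.sinh α * Real.sinc β * α) (nhds 0)
      (nhds (a + lam * (2 * Real.cosh α - 2) - 2 * lam * Real.sinh α * α)) := by
    have : Continuous (fun β => a + lam * (2 * Real.cosh α * Real.cos β - 2)
      - 2 * lam * Real.sinh α * Real.sinc β * α) := by
      have := Real.continuous_sinc; fun_prop
    simpa using this.tendsto 0
  have h1 := hsinc.eventually (lt_mem_nhds hcα)
  have h2 := hfun.eventually (lt_mem_nhds (a := 0) (by linarith))
  have h3 := (h1.and h2).and (gt_mem_nhds (show (0:ℝ) < 1 by norm_num))
  have h4 : ∀ᶠ g in nhdsWithin (0:ℝ) (Set.Ioi 0), _ := (h3.filter_mono nhdsWithin_le_nhds).and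
      self_mem_nhdsWithin
  obtain ⟨β, ⟨⟨k1, k2⟩, k3⟩, k4⟩ := h4.exists
  have k4 : 0 < β := k4
  refine ⟨α, β, 2 * lam * Real.sinh α * Real.sinc β, _, hα0, k4, k3.le, k2, k1, ?_, ?_⟩
  · rw [Real.sinc_of_ne_zero k4.ne']; field_simp
  · linarith

namespace Sol
variable {τ η lam s₀ : ℝ} {I0 : ℤ → ℝ} {u : ℤ → ℝ → ℝ}

theorem spread (h : Sol τ η lam s₀ I0 u) (α β c₁ ε : ℝ) (hα : 0 < α) (hβ : 0 < β) (hβ1 : β ≤ 1)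
    (hε : 0 < ε) (hc : 0 < c₁) (h1 : c₁ * β = 2 * lam * Real.sinh α * Real.sin β)
    (h2 : c₁ * α ≤ (s₀ * τ - η - ε) + lam * (2 * Real.cosh α * Real.cos β - 2)) :
    ∃ κ, 0 < κ ∧ ∀ j : ℤ, ∀ t : ℝ, 0 ≤ (j:ℝ) → (j : ℝ) ≤ c₁ * (t - 1) → κ ≤ u j t := by
  have hτ := h.hτ
  have hη := h.hη
  have hlam := h.hlam
  have hs := h.hs
  set B := Real.exp (α * (Real.pi / 2 / β)) with hB
  have hBpos : 0 < B := Real.exp_pos _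
  -- lower bound at time one
  obtain ⟨m, hm, hmu⟩ : ∃ m, 0 < m ∧ ∀ j : ℤ, 0 < bump α β j → m ≤ u j 1 := by
    set N : ℤ := ⌈Real.pi / 2 / β⌉
    have hN : ∀ j : ℤ, 0 < bump α β j → j ∈ Finset.Icc (-N) N := by
      intro j hj
      obtain ⟨a1, a2⟩ := bump_out α β j hj
      have hle := Int.le_ceil (Real.pi / 2 / β)
      have b1 : (j:ℝ) ≤ Real.pi / 2 / β := by rw [le_div_iff₀ hβ]; linarith
      have b2 : -(j:ℝ) ≤ Real.pi / 2 / β := by rw [le_div_iff₀ hβ]; linarith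
      rw [Finset.mem_Icc]
      constructor
      · have : -(j:ℝ) ≤ (N:ℝ) := b2.trans hle
        have : -j ≤ N := by exact_mod_cast this
        linarith
      · have : (j:ℝ) ≤ (N:ℝ) := b1.trans hle
        exact_mod_cast this
    rcases (Finset.Icc (-N) N).eq_empty_or_nonempty with he | hne
    · exact ⟨1, one_pos, fun j hj => by have := hN j hj; simp [he] at this⟩
    · obtain ⟨k, hk, hkm⟩ := Finset.exists_min_image _ (fun j => u j 1) hne
      exact ⟨u k 1, h.pos k 1 one_pos, fun j hj => hkm j (hN j hj)⟩
  set κ := min (m / B) (ε / (s₀ * τ ^ 2 * B)) with hκ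
  have hκ0 : 0 < κ := lt_min (by positivity) (by positivity)
  have hκ1 : κ * B ≤ m := by
    rw [← le_div_iff₀ hBpos]; exact min_le_left _ _
  have hκ2 : s₀ * τ ^ 2 * (κ * B) ≤ ε := by
    have : κ ≤ ε / (s₀ * τ ^ 2 * B) := min_le_right _ _
    rw [le_div_iff₀ (by positivity)] at this
    linarith
  refine ⟨κ, hκ0, ?_⟩
  have hcomp : ∀ T : ℝ, ∀ j : ℤ, ∀ t ∈ Set.Icc 1 T, κ * bump α β (j - c₁ * (t - 1)) - u j t ≤ 0 := by
    intro T
    refine mp 1 T (s₀ * τ + 2 * lam) (κ * B) (by positivity) (by positivity)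
      (fun j t => κ * bump α β (j - c₁ * (t - 1)) - u j t) ?_ ?_ ?_ ?_
    · intro j
      refine ContinuousOn.sub ?_ (h.cont j zero_le_one)
      have := bump_cont α β
      fun_prop
    · intro j
      simp only [sub_self, mul_zero, sub_zero]
      rcases (bump_nonneg α β j).eq_or_lt with hz | hz
      · rw [← hz]; linarith [h.nonneg j 1 zero_le_one]
      · have a1 := hmu j hz
        have a2 := mul_le_mul_of_nonneg_left (bump_le α β j hα hβ) hκ0.le
        linarith
    · intro j t ht
      have a2 := mul_le_mul_of_nonneg_left (bump_le α β (j - c₁ * (t - 1)) hα hβ) hκ0.le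
      have := h.nonneg j t (by linarith [ht.1])
      linarith
    · intro j t ht hp
      have ht0 : 0 < t := by linarith [ht.1]
      have hu := h.nonneg j t ht0.le
      have hbp : 0 < bump α β (j - c₁ * (t - 1)) := by
        have : 0 < κ * bump α β (j - c₁ * (t - 1)) := by linarith
        exact pos_of_mul_pos_right this hκ0.le
      obtain ⟨d, hd, hdi⟩ := bump_ineq α β _ lam c₁ _ hβ hβ1 hlam h1 h2 hbp
      have hin : HasDerivAt (fun t : ℝ => (j:ℝ) - c₁ * (t - 1)) (-c₁) t := by
        simpa using (((hasDerivAt_id t).sub_const 1).const_mul c₁).const_sub (j:ℝ)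
      have hcd := (hd.comp t hin).const_mul κ
      refine ⟨_, hcd.sub (h.hode j t ht0), ?_⟩
      intro P hP hk
      have k1 := hk j
      have k2 := hk (j-1)
      have k3 := hk (j+1)
      beta_reduce at k1 k2 k3
      have x1 : (((j - 1 : ℤ) : ℝ) - c₁ * (t - 1)) = (j - c₁ * (t - 1)) - 1 := by push_cast; ring
      have x2 : (((j + 1 : ℤ) : ℝ) - c₁ * (t - 1)) = (j - c₁ * (t - 1)) + 1 := by push_cast; ring
      rw [x1] at k2
      rw [x2] at k3
      have hle := bump_le α β (j - c₁ * (t - 1)) hα hβ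
      set x := (j:ℝ) - c₁ * (t - 1)
      have hf := f_lip τ η s₀ hτ hη hs hu (x := κ * bump α β x) (by linarith)
      have hfl := f_low τ η s₀ ε hτ hs (v := κ * bump α β x) (by positivity)
        (le_trans (by gcongr) hκ2)
      have q1 : s₀ * τ * (κ * bump α β x - u j t) ≤ s₀ * τ * P := by gcongr
      have q2 := mul_le_mul_of_nonneg_left hdi hκ0.le
      have q3 := mul_le_mul_of_nonneg_left k2 hlam.le
      have q4 := mul_le_mul_of_nonneg_left k3 hlam.le
      have q5 := h.hI0 j
      have q6 := mul_pos hlam hp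
      nlinarith
  intro j t hj hjt
  have ht1 : 0 ≤ (j:ℝ) / c₁ := by positivity
  have := hcomp (1 + j / c₁) j (1 + j / c₁) ⟨by linarith, le_rfl⟩
  have e : (j:ℝ) - c₁ * (1 + j / c₁ - 1) = 0 := by field_simp; ring
  rw [e, bump_zero] at this
  have hm := h.mono j (t₁ := 1 + j / c₁) (t₂ := t) (by linarith) (by
    have : (j:ℝ) / c₁ ≤ t - 1 := by rw [div_le_iff₀ hc]; linarith
    linarith)
  linarith

set_option maxHeartbeats 2000000 in
theorem converge (h : Sol τ η lam s₀ I0 u) (I : ℤ → ℝ) (M : ℝ) (hM : ∀ j, I j ≤ M)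
    (hpos : ∀ j, 0 < I j)
    (heq : ∀ j : ℤ, 0 = fSIR τ η s₀ (I j) + I0 j + lam * (I (j - 1) - 2 * I j + I (j + 1)))
    (c' δ T₀ : ℝ) (hc' : 0 < c') (hδ : 0 < δ) (hT₀ : 0 < T₀)
    (hlow : ∀ j : ℤ, ∀ t, T₀ ≤ t → |(j:ℝ)| ≤ c' * t → δ ≤ u j t) :
    ∃ κ σ, 0 < κ ∧ 0 < σ ∧ ∀ j : ℤ, ∀ t, T₀ ≤ t → I j - u j t ≤ M *
      (Real.exp (-κ * (t - T₀)) + Real.exp (σ * (j - c' * t)) + Real.exp (σ * (-j - c' * t))) := by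
  have hτ := h.hτ
  have hη := h.hη
  have hlam := h.hlam
  have hs := h.hs
  have hle := fun j t ht => h.le_stat I hpos heq j (t := t) ht
  have hM0 : 0 < M := (hpos 0).trans_le (hM 0)
  have hId : ∀ j, δ ≤ I j := by
    intro j
    have hmx := le_max_left T₀ (|(j:ℝ)| / c')
    refine (hlow j (max T₀ (|(j:ℝ)| / c')) hmx ?_).trans (hle j _ (hT₀.le.trans hmx))
    have := le_max_right T₀ (|(j:ℝ)| / c')
    rw [div_le_iff₀ hc'] at this
    linarith
  set κ₀ := s₀ * Real.exp (-τ * M) * (τ * δ) ^ 2 / 2 with hκ₀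
  have hκ₀p : 0 < κ₀ := by positivity
  set κ := κ₀ / M with hκ
  have hκp : 0 < κ := by positivity
  set E := lam * M / δ with hE
  have hEp : 0 < E := by positivity
  set σ := min 1 (κ / (2 * E + c')) with hσ
  have hσp : 0 < σ := lt_min one_pos (by positivity)
  have hσ1 : σ ≤ 1 := min_le_left _ _
  have hσ2 : E * (Real.exp σ - 1) + σ * c' ≤ κ := by
    have a1 : σ ≤ κ / (2 * E + c') := min_le_right _ _
    rw [le_div_iff₀ (by positivity)] at a1
    have a2 := Real.abs_exp_sub_one_le (x := σ) (by rw [abs_of_pos hσp]; exact hσ1)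
    rw [abs_of_pos hσp] at a2
    have a3 := (le_abs_self _).trans a2
    nlinarith
  refine ⟨κ, σ, hκp, hσp, ?_⟩
  set Z : ℤ → ℝ → ℝ := fun j t =>
    Real.exp (-κ * (t - T₀)) + Real.exp (σ * (j - c' * t)) + Real.exp (σ * (-j - c' * t)) with hZ
  have hZ0 : ∀ j t, 0 < Z j t := fun j t => by simp only [hZ]; positivity
  have hz1 : ∀ j t, 0 ≤ t → 1 - u j t / I j ≤ 1 := fun j t ht => by
    have := div_nonneg (h.nonneg j t ht) (hpos j).le
    linarith
  have hcomp : ∀ T : ℝ, ∀ j : ℤ, ∀ t ∈ Set.Icc T₀ T, 1 - u j t / I j - Z j t ≤ 0 := by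
    intro T
    refine mp T₀ T (2 * E) 1 (by positivity) (by positivity)
      (fun j t => 1 - u j t / I j - Z j t) ?_ ?_ ?_ ?_
    · intro j
      have := h.cont j (T := T) hT₀.le
      simp only [hZ]
      fun_prop
    · intro j
      have a1 := hz1 j T₀ hT₀.le
      have a2 : 1 ≤ Z j T₀ := by
        simp only [hZ, sub_self, mul_zero, Real.exp_zero]
        have := Real.exp_pos (σ * (j - c' * T₀))
        have := Real.exp_pos (σ * (-j - c' * T₀))
        linarith
      linarith
    · intro j t ht
      have a1 := hz1 j t (hT₀.le.trans ht.1)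
      have := hZ0 j t
      linarith
    · intro j t ht hp
      have ht0 : 0 < t := hT₀.trans ht.1
      have a1 := hz1 j t ht0.le
      -- inside the cone
      have hin : |(j:ℝ)| ≤ c' * t := by
        rw [abs_le]
        have q0 := Real.exp_pos (-κ * (t - T₀))
        have q1 := Real.exp_pos (σ * (j - c' * t))
        have q2 := Real.exp_pos (σ * (-j - c' * t))
        have hZlt : Z j t < 1 := by linarith
        simp only [hZ] at hZlt
        constructor
        · by_contra! hcon
          have : 1 ≤ Real.exp (σ * (-j - c' * t)) := Real.one_le_exp (by
            apply mul_nonneg hσp.le; linarith)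
          linarith
        · by_contra! hcon
          have : 1 ≤ Real.exp (σ * (j - c' * t)) := Real.one_le_exp (by
            apply mul_nonneg hσp.le; linarith)
          linarith
      have hul := hlow j t ht.1.le hin
      have huI := hle j t ht0.le
      have hI := hpos j
      have dz : HasDerivAt (fun t => 1 - u j t / I j) _ t :=
        ((h.hode j t ht0).div_const (I j)).const_sub 1
      have d0 : HasDerivAt (fun t => Real.exp (-κ * (t - T₀)))
          (Real.exp (-κ * (t - T₀)) * (-κ)) t := by
        simpa using (((hasDerivAt_id t).sub_const T₀).const_mul (-κ)).exp
      have d1 : HasDerivAt (fun t => Real.exp (σ * (j - c' * t)))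
          (Real.exp (σ * (j - c' * t)) * (σ * -c')) t := by
        simpa using ((((hasDerivAt_id t).const_mul c').const_sub (j:ℝ)).const_mul σ).exp
      have d2 : HasDerivAt (fun t => Real.exp (σ * (-j - c' * t)))
          (Real.exp (σ * (-j - c' * t)) * (σ * -c')) t := by
        simpa using ((((hasDerivAt_id t).const_mul c').const_sub (-(j:ℝ))).const_mul σ).exp
      refine ⟨_, dz.sub ((d0.add d1).add d2), ?_⟩
      intro P hP hk
      have k1 := hk j
      have k2 := hk (j-1)
      have k3 := hk (j+1)
      beta_reduce at k1 k2 k3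
      -- names
      obtain ⟨z, hz⟩ : ∃ z, z = 1 - u j t / I j := ⟨_, rfl⟩
      obtain ⟨zm, hzm⟩ : ∃ z, z = 1 - u (j-1) t / I (j-1) := ⟨_, rfl⟩
      obtain ⟨zp, hzp⟩ : ∃ z, z = 1 - u (j+1) t / I (j+1) := ⟨_, rfl⟩
      have hu0 : u j t = (1 - z) * I j := by rw [hz]; field_simp; ring
      have hum : u (j-1) t = (1 - zm) * I (j-1) := by
        have := (hpos (j-1)).ne'
        rw [hzm]; field_simp; ring
      have hup : u (j+1) t = (1 - zp) * I (j+1) := by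
        have := (hpos (j+1)).ne'
        rw [hzp]; field_simp; ring
      have hz0 : 0 ≤ z := by
        rw [hz, sub_nonneg, div_le_one hI]; exact huI
      have hconc := f_conc τ η s₀ δ M (I j) (u j t) z hτ hs hδ hul hz0 hu0 (hM j) huI
      rw [← hκ₀] at hconc
      rw [← hz] at k1 hp
      rw [← hzm] at k2
      rw [← hzp] at k3
      have hZm : Z (j-1) t - Z j t ≤ Real.exp (σ * (-j - c' * t)) * (Real.exp σ - 1) := by
        have p1 : Real.exp (σ * (((j - 1 : ℤ):ℝ) - c' * t)) ≤ Real.exp (σ * (j - c' * t)) := by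
          apply Real.exp_le_exp.2; push_cast; nlinarith
        have p2 : Real.exp (σ * (-((j - 1 : ℤ):ℝ) - c' * t))
            = Real.exp (σ * (-j - c' * t)) * Real.exp σ := by
          rw [← Real.exp_add]; push_cast; ring_nf
        simp only [hZ, p2]; linarith
      have hZp : Z (j+1) t - Z j t ≤ Real.exp (σ * (j - c' * t)) * (Real.exp σ - 1) := by
        have p1 : Real.exp (σ * (-((j + 1 : ℤ):ℝ) - c' * t)) ≤ Real.exp (σ * (-j - c' * t)) := by
          apply Real.exp_le_exp.2; push_cast; nlinarith
        have p2 : Real.exp (σ * (((j + 1 : ℤ):ℝ) - c' * t))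
            = Real.exp (σ * (j - c' * t)) * Real.exp σ := by
          rw [← Real.exp_add]; push_cast; ring_nf
        simp only [hZ, p2]; linarith
      have hZj : Z j t = Real.exp (-κ * (t - T₀)) + Real.exp (σ * (j - c' * t))
        + Real.exp (σ * (-j - c' * t)) := rfl
      have q0 := Real.exp_pos (-κ * (t - T₀))
      have q1 := Real.exp_pos (σ * (j - c' * t))
      have q2 := Real.exp_pos (σ * (-j - c' * t))
      set e0 := Real.exp (-κ * (t - T₀))
      set e1 := Real.exp (σ * (j - c' * t))
      set e2 := Real.exp (σ * (-j - c' * t))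
      have hex : 0 ≤ Real.exp σ - 1 := by linarith [Real.add_one_le_exp σ]
      obtain ⟨A, hA⟩ : ∃ A, A = lam * I (j-1) / I j := ⟨_, rfl⟩
      obtain ⟨B, hB⟩ : ∃ B, B = lam * I (j+1) / I j := ⟨_, rfl⟩
      have hA0 : 0 ≤ A := by have := hpos (j-1); rw [hA]; positivity
      have hB0 : 0 ≤ B := by have := hpos (j+1); rw [hB]; positivity
      have hAE : A ≤ E := by
        have := hM (j-1)
        have := hId j
        rw [hA, hE]; gcongr
      have hBE : B ≤ E := by
        have := hM (j+1)
        have := hId j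
        rw [hB, hE]; gcongr
      have main : -((fSIR τ η s₀ (u j t) + I0 j + lam * (u (j - 1) t - 2 * u j t + u (j + 1) t)) / I j)
          ≤ -κ * z + A * (zm - z) + B * (zp - z) := by
        have r1 : A * (zm - z) * I j = lam * I (j-1) * (zm - z) := by rw [hA]; field_simp
        have r2 : B * (zp - z) * I j = lam * I (j+1) * (zp - z) := by rw [hB]; field_simp
        have r3 : κ * z * I j ≤ κ₀ * z := by
          rw [hκ]
          have : I j / M ≤ 1 := (div_le_one hM0).2 (hM j)
          calc κ₀ / M * z * I j = κ₀ * z * (I j / M) := by ring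
            _ ≤ κ₀ * z * 1 := by gcongr
            _ = _ := by ring
        rw [← neg_div, div_le_iff₀ hI]
        have r4 := heq j
        have r5 := mul_nonneg hz0 (h.hI0 j)
        have r6 : lam * (u (j - 1) t - 2 * u j t + u (j + 1) t) =
          (1 - z) * (lam * (I (j - 1) - 2 * I j + I (j + 1)))
            - lam * I (j-1) * (zm - z) - lam * I (j+1) * (zp - z) := by
          rw [hu0, hum, hup]; ring
        rw [r6]
        have r7 : lam * (I (j - 1) - 2 * I j + I (j + 1)) = - fSIR τ η s₀ (I j) - I0 j := by
          linarith
        rw [r7]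
        linarith
      have s1 : A * (zm - z) ≤ A * P + E * (e2 * (Real.exp σ - 1)) := by
        have t1 : zm - z ≤ P + e2 * (Real.exp σ - 1) := by linarith
        have t2 := mul_le_mul_of_nonneg_left t1 hA0
        have t3 := mul_le_mul_of_nonneg_right hAE (mul_nonneg q2.le hex)
        linarith
      have s2 : B * (zp - z) ≤ B * P + E * (e1 * (Real.exp σ - 1)) := by
        have t1 : zp - z ≤ P + e1 * (Real.exp σ - 1) := by linarith
        have t2 := mul_le_mul_of_nonneg_left t1 hB0
        have t3 := mul_le_mul_of_nonneg_right hBE (mul_nonneg q1.le hex)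
        linarith
      have s3 := mul_le_mul_of_nonneg_right hAE hP
      have s4 := mul_le_mul_of_nonneg_right hBE hP
      have s5 := mul_le_mul_of_nonneg_right hσ2 (add_pos q1 q2).le
      have s6 : κ * (e0 + e1 + e2) ≤ κ * z := by
        apply mul_le_mul_of_nonneg_left _ hκp.le; linarith
      linarith
  intro j t ht
  have h1 := hcomp t j t ⟨ht, le_rfl⟩
  have hI := hpos j
  have h2 : I j - u j t = I j * (1 - u j t / I j) := by field_simp
  rw [h2]
  change _ ≤ M * Z j t
  calc _ ≤ I j * Z j t := by gcongr; linarith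
    _ ≤ _ := by have := hM j; have := hZ0 j t; gcongr

end Sol
/-- Inner spreading on the lattice: assume `𝓡₀ = s₀τ/η > 1` and let
`c_* = min_{γ>0} [η(𝓡₀-1) + λ(e^{-γ} - 2 + e^{γ})]/γ`. Then for every `c ∈ (0, c_*)`,
`sup_{|j| ≤ ct} |𝓘_j(t) - I_j^∞| → 0` as `t → +∞`, where `(I_j^∞)` is the unique
positive bounded stationary solution. -/
theorem stmt_4 (τ η lam s₀ : ℝ) (hτ : 0 < τ) (hη : 0 < η) (hlam : 0 < lam)
    (hs₀ : s₀ ∈ Set.Ioo (0 : ℝ) 1) (hR0 : 1 < s₀ * τ / η)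
    (I0 : ℤ → ℝ) (hI0 : ∀ j, 0 ≤ I0 j ∧ I0 j ≤ 1)
    (hI0ne : ∃ j, I0 j ≠ 0) (hI0fin : (Function.support I0).Finite)
    (cstar : ℝ)
    (hcstar : IsLeast {v : ℝ | ∃ γ : ℝ, 0 < γ ∧
        v = (η * (s₀ * τ / η - 1) + lam * (Real.exp (-γ) - 2 + Real.exp γ)) / γ} cstar)
    (𝓘 : ℤ → ℝ → ℝ)
    (hcont : ∀ j, ContinuousOn (𝓘 j) (Set.Ici (0 : ℝ)))
    (hode : ∀ j : ℤ, ∀ t : ℝ, 0 < t → HasDerivAt (𝓘 j)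
        (fSIR τ η s₀ (𝓘 j t) + I0 j
          + lam * (𝓘 (j - 1) t - 2 * 𝓘 j t + 𝓘 (j + 1) t)) t)
    (hbdd : ∀ T : ℝ, 0 < T → ∃ M : ℝ, ∀ j : ℤ, ∀ t ∈ Set.Icc (0 : ℝ) T, |𝓘 j t| ≤ M)
    (hinit : ∀ j : ℤ, 𝓘 j 0 = 0)
    (Iinf : ℤ → ℝ)
    (hpos : ∀ j, 0 < Iinf j) (hIbdd : ∃ M : ℝ, ∀ j, Iinf j ≤ M)
    (heq : ∀ j : ℤ, 0 = fSIR τ η s₀ (Iinf j) + I0 j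
        + lam * (Iinf (j - 1) - 2 * Iinf j + Iinf (j + 1))) :
    ∀ c : ℝ, 0 < c → c < cstar → ∀ ε : ℝ, 0 < ε →
      ∀ᶠ t : ℝ in Filter.atTop,
        ∀ j : ℤ, |(j : ℝ)| ≤ c * t → |𝓘 j t - Iinf j| ≤ ε := by
  intro c hc0 hc ε hε
  have hsol : Sol τ η lam s₀ I0 𝓘 :=
    ⟨hτ, hη, hlam, hs₀.1, fun j => (hI0 j).1, hI0ne, hcont, hode, hbdd, hinit⟩
  have ha : η * (s₀ * τ / η - 1) = s₀ * τ - η := by field_simp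
  rw [ha] at hcstar
  obtain ⟨⟨γ, hγ, hcs⟩, hlb⟩ := hcstar
  obtain ⟨α, β, c₁, e, hα, hβ, hβ1, he, hcc, p1, p2⟩ := exists_params (s₀ * τ - η) lam γ cstar c
    hlam hγ hc0 hcs (fun g hg => hlb ⟨g, hg, rfl⟩) hc
  have hc₁ : 0 < c₁ := hc0.trans hcc
  obtain ⟨κ₁, hκ₁, hs1⟩ := hsol.spread α β c₁ e hα hβ hβ1 he hc₁ p1 p2
  obtain ⟨κ₂, hκ₂, hs2⟩ := hsol.reflect.spread α β c₁ e hα hβ hβ1 he hc₁ p1 p2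
  obtain ⟨M, hM⟩ := hIbdd
  obtain ⟨c', hcc', hc'c₁⟩ := exists_between hcc
  have hc' : 0 < c' := hc0.trans hcc'
  have hT : 0 < c₁ / (c₁ - c') := div_pos hc₁ (by linarith)
  obtain ⟨κ, σ, hκ, hσ, hfin⟩ := hsol.converge Iinf M hM hpos heq c' (min κ₁ κ₂) (c₁ / (c₁ - c'))
    hc' (lt_min hκ₁ hκ₂) hT (by
      intro j t ht hj
      rw [div_le_iff₀ (by linarith)] at ht
      have hj' : |(j:ℝ)| ≤ c₁ * (t - 1) := by linarith
      rcases le_total 0 (j:ℝ) with h0 | h0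
      · exact (min_le_left _ _).trans (hs1 j t h0 ((le_abs_self _).trans hj'))
      · have := hs2 (-j) t (by push_cast; linarith) (by
          push_cast; exact (neg_le_abs _).trans hj')
        simp only [neg_neg] at this
        exact (min_le_right _ _).trans this)
  have hM0 : 0 < M := (hpos 0).trans_le (hM 0)
  have hl : Filter.Tendsto (fun t : ℝ => M * (Real.exp (-κ * (t - c₁ / (c₁ - c')))
      + Real.exp (-(σ * (c' - c)) * t) + Real.exp (-(σ * (c' - c)) * t))) Filter.atTop
      (nhds (M * (0 + 0 + 0))) := by
    have t1 : Filter.Tendsto (fun t : ℝ => Real.exp (-(σ * (c' - c)) * t)) Filter.atTop (nhds 0) := by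
      apply Real.tendsto_exp_atBot.comp
      apply Filter.Tendsto.const_mul_atTop_of_neg _ Filter.tendsto_id
      have : 0 < σ * (c' - c) := mul_pos hσ (by linarith)
      linarith
    have t2 : Filter.Tendsto (fun t : ℝ => Real.exp (-κ * (t - c₁ / (c₁ - c')))) Filter.atTop
        (nhds 0) := by
      apply Real.tendsto_exp_atBot.comp
      apply Filter.Tendsto.const_mul_atTop_of_neg (by linarith)
      exact Filter.tendsto_atTop_add_const_right _ _ Filter.tendsto_id
    exact ((t2.add t1).add t1).const_mul M
  have hev := hl.eventually_lt_const (show M * (0 + 0 + 0) < ε by simpa using hε)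
  filter_upwards [hev, Filter.eventually_ge_atTop (c₁ / (c₁ - c'))] with t h1 h2 j hj
  have hle := hsol.le_stat Iinf hpos heq j (t := t) (hT.le.trans h2)
  rw [abs_sub_comm, abs_of_nonneg (by linarith)]
  refine (hfin j t h2).trans (le_trans ?_ h1.le)
  obtain ⟨hj1, hj2⟩ := abs_le.1 hj
  have g1 : Real.exp (σ * (j - c' * t)) ≤ Real.exp (-(σ * (c' - c)) * t) :=
    Real.exp_le_exp.2 (by nlinarith [mul_le_mul_of_nonneg_left hj2 hσ.le])
  have g2 : Real.exp (σ * (-j - c' * t)) ≤ Real.exp (-(σ * (c' - c)) * t) :=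
    Real.exp_le_exp.2 (by nlinarith [mul_le_mul_of_nonneg_left hj1 hσ.le])
  exact mul_le_mul_of_nonneg_left (by linarith) hM0.le
end

section
/- Assume 𝓡₀ > 1 and define c_* := min_{γ>0} [η(𝓡₀ - 1) + λ(e^{-γ} - 2 + e^{γ})]/γ. Let (𝓘_j(t))_{j∈ℤ} be the solution of 𝓘_j'(t) = f(𝓘_j(t)) + I_j^0 + λ(𝓘_{j-1}(t) - 2𝓘_j(t) + 𝓘_{j+1}(t)) with 𝓘_j(0) = 0 for all j ∈ ℤ. Then for every c > c_*, limsup_{t→+∞} sup_{|j| ≥ ct} |𝓘_j(t)| = 0. -/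
open Set Filter Topology in
lemma lattice_max (T a lam M : ℝ) (hT : 0 < T) (ha : 0 ≤ a) (hl : 0 < lam)
    (w w' : ℤ → ℝ → ℝ)
    (hc : ∀ j, ContinuousOn (w j) (Ici 0))
    (hd : ∀ j t, 0 < t → HasDerivAt (w j) (w' j t) t)
    (hM : ∀ j, ∀ t ∈ Icc (0:ℝ) T, w j t ≤ M)
    (h0 : ∀ j, w j 0 ≤ 0)
    (hle : ∀ j t, 0 < t → t ≤ T → 0 < w j t →
      w' j t ≤ a * w j t + lam * (w (j-1) t - 2 * w j t + w (j+1) t)) :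
    ∀ j, ∀ t ∈ Icc (0:ℝ) T, w j t ≤ 0 := by
  set B : ℝ := 4 * (a + 2 * lam) with hB
  have hBpos : 0 < B := by positivity
  have step : ∀ S : ℝ, 0 < S → (∀ j, ∀ t ∈ Icc (0:ℝ) T, w j t ≤ S * Real.exp (B * t)) →
      ∀ j, ∀ t ∈ Icc (0:ℝ) T, w j t ≤ S / 2 * Real.exp (B * t) := by
    intro S hS hw j t ht
    rcases eq_or_lt_of_le ht.1 with h | htp
    · rw [← h]
      have := h0 j
      have : 0 < S / 2 * Real.exp (B * 0) := by positivity
      linarith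
    have hev : ∀ᶠ x in 𝓝[>] (0:ℝ), w j x < S / 2 := by
      have : Tendsto (w j) (𝓝[>] 0) (𝓝 (w j 0)) :=
        ((hc j) 0 (by simp)).mono_left (nhdsWithin_mono _ Ioi_subset_Ici_self)
      exact this.eventually_lt_const (by have := h0 j; linarith)
    have hev2 : ∀ᶠ x in 𝓝[>] (0:ℝ), x ∈ Ioo 0 t := Ioo_mem_nhdsGT htp
    obtain ⟨d, hd1, hd2⟩ := (hev.and hev2).exists
    have hder : ∀ x, HasDerivAt (fun x => S / 2 * Real.exp (B * x))
        (S / 2 * (Real.exp (B * x) * B)) x := by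
      intro x
      have h1 : HasDerivAt (fun x : ℝ => B * x) B x := by
        simpa using (hasDerivAt_id x).const_mul B
      exact h1.exp.const_mul (S / 2)
    refine image_le_of_deriv_right_lt_deriv_boundary (f := w j) (f' := w' j) (a := d) (b := t)
      (B := fun x => S / 2 * Real.exp (B * x))
      (B' := fun x => S / 2 * (Real.exp (B * x) * B)) ?_ ?_ ?_ hder ?_ ⟨hd2.2.le, le_rfl⟩
    · exact (hc j).mono fun x hx => hd2.1.le.trans hx.1
    · intro x hx
      exact (hd j x (hd2.1.trans_le hx.1)).hasDerivWithinAt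
    · have : (1:ℝ) ≤ Real.exp (B * d) := Real.one_le_exp (mul_nonneg hBpos.le hd2.1.le)
      have : S / 2 * 1 ≤ S / 2 * Real.exp (B * d) := by gcongr
      show w j d ≤ S / 2 * Real.exp (B * d)
      linarith
    · intro x hx heq
      have hx0 : 0 < x := hd2.1.trans_le hx.1
      have hxT : x ≤ T := hx.2.le.trans ht.2
      have hE := Real.exp_pos (B * x)
      have hSE : 0 < S * Real.exp (B * x) := by positivity
      have hpos : 0 < w j x := by rw [heq]; positivity
      have h1 := hle j x hx0 hxT hpos
      have h2 := hw (j-1) x ⟨hx0.le, hxT⟩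
      have h3 := hw (j+1) x ⟨hx0.le, hxT⟩
      have heq' : w j x = S * Real.exp (B * x) / 2 := by rw [heq]; ring
      show w' j x < S / 2 * (Real.exp (B * x) * B)
      have e : S / 2 * (Real.exp (B * x) * B) = 2 * (a + 2 * lam) * (S * Real.exp (B * x)) := by
        rw [hB]; ring
      rw [e]
      rw [heq'] at h1
      generalize S * Real.exp (B * x) = E at *
      have h4 : lam * (w (j-1) x - 2 * (E/2) + w (j+1) x) ≤ lam * E :=
        mul_le_mul_of_nonneg_left (by linarith) hl.le
      have h5 : 0 < lam * E := by positivity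
      have h6 : 0 ≤ a * E := by positivity
      nlinarith
  have hall : ∀ n : ℕ, ∀ j, ∀ t ∈ Icc (0:ℝ) T,
      w j t ≤ (|M| + 1) * (1/2)^n * Real.exp (B * t) := by
    intro n
    induction n with
    | zero =>
      intro j t ht
      have h1 := hM j t ht
      have h2 : (1:ℝ) ≤ Real.exp (B * t) := Real.one_le_exp (mul_nonneg hBpos.le ht.1)
      have h3 := le_abs_self M
      have h4 := abs_nonneg M
      simp only [pow_zero, mul_one]
      nlinarith
    | succ n ih =>
      intro j t ht
      have := step _ (by positivity) ih j t ht
      refine this.trans (le_of_eq ?_)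
      rw [pow_succ]; ring
  intro j t ht
  have hlim : Tendsto (fun n : ℕ => (|M| + 1) * (1/2:ℝ)^n * Real.exp (B * t)) atTop
      (𝓝 ((|M| + 1) * 0 * Real.exp (B * t))) :=
    ((tendsto_pow_atTop_nhds_zero_of_lt_one (by norm_num) (by norm_num)).const_mul _).mul_const _
  have := ge_of_tendsto' hlim (fun n => hall n j t ht)
  simpa using this


/-- Outer spreading on the lattice: assume `𝓡₀ = s₀τ/η > 1` and let
`c_* = min_{γ>0} [η(𝓡₀-1) + λ(e^{-γ} - 2 + e^{γ})]/γ`. Then for every `c > c_*`,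

`sup_{|j| ≥ ct} |𝓘_j(t)| → 0` as `t → +∞`. -/
theorem stmt_5 (τ η lam s₀ : ℝ) (hτ : 0 < τ) (hη : 0 < η) (hlam : 0 < lam)
    (hs₀ : s₀ ∈ Set.Ioo (0 : ℝ) 1) (hR0 : 1 < s₀ * τ / η)
    (I0 : ℤ → ℝ) (hI0 : ∀ j, 0 ≤ I0 j ∧ I0 j ≤ 1)
    (hI0ne : ∃ j, I0 j ≠ 0) (hI0fin : (Function.support I0).Finite)
    (cstar : ℝ)
    (hcstar : IsLeast {v : ℝ | ∃ γ : ℝ, 0 < γ ∧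
        v = (η * (s₀ * τ / η - 1) + lam * (Real.exp (-γ) - 2 + Real.exp γ)) / γ} cstar)
    (𝓘 : ℤ → ℝ → ℝ)
    (hcont : ∀ j, ContinuousOn (𝓘 j) (Set.Ici (0 : ℝ)))
    (hode : ∀ j : ℤ, ∀ t : ℝ, 0 < t → HasDerivAt (𝓘 j)
        (fSIR τ η s₀ (𝓘 j t) + I0 j
          + lam * (𝓘 (j - 1) t - 2 * 𝓘 j t + 𝓘 (j + 1) t)) t)
    (hbdd : ∀ T : ℝ, 0 < T → ∃ M : ℝ, ∀ j : ℤ, ∀ t ∈ Set.Icc (0 : ℝ) T, |𝓘 j t| ≤ M)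
    (hinit : ∀ j : ℤ, 𝓘 j 0 = 0) :
    ∀ c : ℝ, cstar < c → ∀ ε : ℝ, 0 < ε →
      ∀ᶠ t : ℝ in Filter.atTop,
        ∀ j : ℤ, c * t ≤ |(j : ℝ)| → |𝓘 j t| ≤ ε := by
  intro c hc ε hε
  obtain ⟨⟨γ, hγ, hcs⟩, -⟩ := hcstar
  have hηs : η * (s₀ * τ / η - 1) = s₀ * τ - η := by field_simp
  rw [hηs] at hcs
  have hs := hs₀.1
  have ha : 0 < s₀ * τ - η := by
    rw [lt_div_iff₀ hη] at hR0; linarith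
  set a := s₀ * τ - η with ha_def
  -- nonnegativity
  have hlow : ∀ j t, 0 < t → 0 ≤ 𝓘 j t := by
    intro j t ht
    obtain ⟨M, hM⟩ := hbdd t ht
    have hM0 : 0 ≤ M := (abs_nonneg _).trans (hM 0 0 ⟨le_rfl, ht.le⟩)
    have key := lattice_max t (s₀ * τ * Real.exp (τ * M)) lam M ht (by positivity) hlam
      (fun j t => - 𝓘 j t) _ (fun j => (hcont j).neg) (fun j t ht => (hode j t ht).neg)
      (fun j s hs => (neg_le_abs _).trans (hM j s hs)) (fun j => by simp [hinit])
      (by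
        intro j s hs0 hst hpos
        have hb := (neg_le_abs _).trans (hM j s ⟨hs0.le, hst⟩)
        have hI := (hI0 j).1
        simp only [fSIR]
        set v := - 𝓘 j s with hv
        have hvv : 𝓘 j s = - v := by rw [hv]; ring
        rw [hvv]
        have e1 : -τ * -v = τ * v := by ring
        rw [e1]
        have h1 : 1 - τ * v ≤ Real.exp (-(τ * v)) := by
          have := Real.add_one_le_exp (-(τ * v)); linarith
        have h2 : Real.exp (τ * v) * Real.exp (-(τ * v)) = 1 := by
          rw [← Real.exp_add]; simp
        have h3 : Real.exp (τ * v) - 1 ≤ τ * v * Real.exp (τ * v) := by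
          nlinarith [Real.exp_pos (τ * v)]
        have h4 : Real.exp (τ * v) ≤ Real.exp (τ * M) :=
          Real.exp_le_exp.2 (by gcongr)
        have h5 : Real.exp (τ * v) - 1 ≤ τ * v * Real.exp (τ * M) :=
          h3.trans (mul_le_mul_of_nonneg_left h4 (by positivity))
        have h6 := mul_le_mul_of_nonneg_left h5 hs.le
        have h7 : 0 < η * v := by positivity
        nlinarith) j t ⟨ht.le, le_rfl⟩
    simpa using key
  -- exponents
  set A := a + lam * (Real.exp (-γ) - 2 + Real.exp γ) with hA
  have hApos : 0 < A := by
    have h1 := Real.add_one_le_exp (-γ)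
    have h2 := Real.add_one_le_exp γ
    have : 0 ≤ lam * (Real.exp (-γ) - 2 + Real.exp γ) := mul_nonneg hlam.le (by linarith)
    linarith
  have hAc : A < γ * c := by
    rw [hcs, div_lt_iff₀ hγ] at hc; linarith
  set δ := (γ * c - A) / 2 with hδ
  have hδpos : 0 < δ := by rw [hδ]; linarith
  obtain ⟨N, hN⟩ : ∃ N : ℝ, ∀ j, I0 j ≠ 0 → |(j:ℝ)| ≤ N := by
    obtain ⟨N, hN⟩ := (hI0fin.image (fun j : ℤ => |(j:ℝ)|)).bddAbove
    exact ⟨N, fun j hj => hN ⟨j, hj, rfl⟩⟩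
  set K := Real.exp (γ * N) / δ with hK
  have hKpos : 0 < K := by positivity
  have hup : ∀ g : ℝ, |g| = γ → A = a + lam * (Real.exp (-g) - 2 + Real.exp g) →
      ∀ j t, 0 < t → 𝓘 j t ≤ K * Real.exp (g * j + (A + δ) * t) := by
    intro g hg hAg j t ht
    obtain ⟨M, hM⟩ := hbdd t ht
    have hud : ∀ (j : ℤ) (t : ℝ), HasDerivAt (fun t => K * Real.exp (g * j + (A + δ) * t))
        (K * (Real.exp (g * j + (A + δ) * t) * (A + δ))) t := by
      intro j t
      have h1 : HasDerivAt (fun t : ℝ => g * j + (A + δ) * t) (A + δ) t := by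
        simpa using ((hasDerivAt_id t).const_mul (A + δ)).const_add (g * j)
      exact h1.exp.const_mul K
    have key := lattice_max t a lam M ht ha.le hlam
      (fun j t => 𝓘 j t - K * Real.exp (g * j + (A + δ) * t)) _
      (fun j => (hcont j).sub (fun x _ => (hud j x).continuousAt.continuousWithinAt))
      (fun j t ht => (hode j t ht).sub (hud j t))
      (fun j s hs => by
        have h1 := (le_abs_self _).trans (hM j s hs)
        have : 0 < K * Real.exp (g * j + (A + δ) * s) := by positivity
        linarith)
      (fun j => by
        rw [hinit]
        have : 0 < K * Real.exp (g * j + (A + δ) * 0) := by positivity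
        linarith)
      (by
        intro j s hs0 hst _
        have em : Real.exp (g * ((j - 1 : ℤ) : ℝ) + (A + δ) * s)
            = Real.exp (-g) * Real.exp (g * j + (A + δ) * s) := by
          rw [← Real.exp_add]; push_cast; ring_nf
        have ep : Real.exp (g * ((j + 1 : ℤ) : ℝ) + (A + δ) * s)
            = Real.exp g * Real.exp (g * j + (A + δ) * s) := by
          rw [← Real.exp_add]; push_cast; ring_nf
        have hI : I0 j ≤ δ * (K * Real.exp (g * j + (A + δ) * s)) := by
          by_cases h : I0 j = 0
          · rw [h]; positivity
          · refine (hI0 j).2.trans ?_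
            have e : δ * (K * Real.exp (g * j + (A + δ) * s))
                = Real.exp (γ * N + (g * j + (A + δ) * s)) := by
              rw [Real.exp_add (γ * N), ← mul_assoc, hK, mul_div_cancel₀ _ hδpos.ne']
            rw [e]
            apply Real.one_le_exp
            have h1 : |g * j| ≤ γ * N := by
              rw [abs_mul, hg]; exact mul_le_mul_of_nonneg_left (hN j h) hγ.le
            have h2 := neg_abs_le (g * j)
            have h3 : 0 < (A + δ) * s := by positivity
            linarith
        have hf : fSIR τ η s₀ (𝓘 j s) ≤ a * 𝓘 j s := by
          have h1 := Real.add_one_le_exp (-τ * 𝓘 j s)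
          have h2 : s₀ * (1 - Real.exp (-τ * 𝓘 j s)) ≤ s₀ * (τ * 𝓘 j s) :=
            mul_le_mul_of_nonneg_left (by linarith) hs.le
          simp only [fSIR, ha_def]
          linarith
        simp only [em, ep]
        generalize Real.exp (g * j + (A + δ) * s) = E at *
        have e2 : K * (E * (A + δ)) = a * (K * E)
            + lam * (K * (Real.exp (-g) * E) - 2 * (K * E) + K * (Real.exp g * E))
            + δ * (K * E) := by rw [hAg]; ring
        rw [e2]
        linarith) j t ⟨ht.le, le_rfl⟩
    have key' : 𝓘 j t - K * Real.exp (g * j + (A + δ) * t) ≤ 0 := key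
    linarith
  have hlim : Filter.Tendsto (fun t : ℝ => K * Real.exp (-(δ * t))) Filter.atTop (nhds (K * 0)) := by
    refine Filter.Tendsto.const_mul K ?_
    exact Real.tendsto_exp_neg_atTop_nhds_zero.comp (Filter.tendsto_id.const_mul_atTop hδpos)
  rw [mul_zero] at hlim
  filter_upwards [hlim.eventually_lt_const hε, Filter.eventually_gt_atTop 0] with t h1 ht j hj
  rw [abs_of_nonneg (hlow j t ht)]
  have hfin : γ * (c * t) ≤ γ * |(j:ℝ)| := mul_le_mul_of_nonneg_left hj hγ.le
  have hexp : -(γ * |(j:ℝ)|) + (A + δ) * t ≤ -(δ * t) := by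
    have : A + δ = γ * c - δ := by rw [hδ]; ring
    rw [this]; nlinarith
  have hbd : 𝓘 j t ≤ K * Real.exp (-(γ * |(j:ℝ)|) + (A + δ) * t) := by
    rcases le_total 0 (j:ℝ) with h | h
    · have := hup (-γ) (by rw [abs_neg, abs_of_pos hγ]) (by rw [hA, neg_neg]; ring) j t ht
      rw [abs_of_nonneg h]; rwa [neg_mul] at this
    · have := hup γ (abs_of_pos hγ) hA j t ht
      rw [abs_of_nonpos h]; rwa [mul_neg, neg_neg]
  have : K * Real.exp (-(γ * |(j:ℝ)|) + (A + δ) * t) ≤ K * Real.exp (-(δ * t)) := by gcongr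
  linarith
end
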